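/- arXiv:1512.06640 — 3 statements merged into one kernel-verified Lean document; each statement's English description precedes it below -/
import Mathlib

section
/- Let ε > 0 and let μ, ν ∈ M be such that the set A_μ^ν := { θ ∈ B∞(μ, ε) : ν ≤_c θ } is nonempty. Then A_μ^ν contains a least element S_ν(μ) with respect to convex order: ν ≤_c S_ν(μ) ≤_c θ for every θ ∈ A_μ^ν. Equivalently, there exists a pointwise smallest call function R* that dominates R_ν pointwise and satisfies R'_μ(x−ε) ≤ (R*)'(x) ≤ R'_μ(x+ε) for all x ∈ ℝ. -/
open MeasureTheory Filter Set
open scoped ENNReal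

/-- Call function `R_μ(x) = ∫ (y−x)⁺ μ(dy)`. -/
noncomputable def callFn (μ : Measure ℝ) (x : ℝ) : ℝ := ∫ y, max (y - x) 0 ∂μ

/-- Mean `Eμ = ∫ y μ(dy)`. -/
noncomputable def meanM (μ : Measure ℝ) : ℝ := ∫ y, y ∂μ

/-- Distribution function `F_μ(x) = μ((−∞,x])`. -/
noncomputable def cdfM (μ : Measure ℝ) (x : ℝ) : ℝ := (μ (Set.Iic x)).toReal

/-- Membership in `M`: Borel probability measure on ℝ with finite first moment. -/
def MemM (μ : Measure ℝ) : Prop :=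
  IsProbabilityMeasure μ ∧ Integrable (fun y => y) μ

/-- Convex order `μ ≤_c ν`. -/
def ConvexOrder (μ ν : Measure ℝ) : Prop :=
  ∀ φ : ℝ → ℝ, ConvexOn ℝ Set.univ φ → Integrable φ μ → Integrable φ ν →
    ∫ y, φ y ∂μ ≤ ∫ y, φ y ∂ν

/-- Infinity Wasserstein distance via distribution functions, valued in `[0,∞]`,
with `inf ∅ = ∞`. -/
noncomputable def Winf (μ ν : Measure ℝ) : ℝ≥0∞ :=
  sInf (ENNReal.ofReal '' {ε : ℝ | 0 < ε ∧ ∀ x : ℝ,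
    cdfM μ (x - ε) ≤ cdfM ν x ∧ cdfM ν x ≤ cdfM μ (x + ε)})

/-- Membership in the closed ball `B^∞(μ,ε)` (within `M`). -/
def InBallWinf (μ : Measure ℝ) (ε : ℝ) (ν : Measure ℝ) : Prop :=
  MemM ν ∧ Winf μ ν ≤ ENNReal.ofReal ε

/-- `conv2 f g`: the largest convex function majorized by `min f g`, pointwise. -/
noncomputable def conv2 (f g : ℝ → ℝ) (x : ℝ) : ℝ :=
  sSup {z : ℝ | ∃ h : ℝ → ℝ, ConvexOn ℝ Set.univ h ∧ (∀ y, h y ≤ min (f y) (g y)) ∧ z = h x}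

/-- `R^min_μ(x; m, ε)`. -/
noncomputable def RminW (μ : Measure ℝ) (m ε x : ℝ) : ℝ :=
  max (m + callFn μ (x - ε) - (meanM μ + ε)) (callFn μ (x + ε))

/-- `R^max_μ(x; m, ε)`. -/
noncomputable def RmaxW (μ : Measure ℝ) (m ε x : ℝ) : ℝ :=
  conv2 (fun y => m + callFn μ (y + ε) - (meanM μ - ε)) (fun y => callFn μ (y - ε)) x

/-- Right derivative. -/
noncomputable def rderiv (f : ℝ → ℝ) (x : ℝ) : ℝ := derivWithin f (Set.Ioi x) x

/-- `R` is a call function: convex, nonincreasing, tending to `0` at `+∞`, and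
`R(x)+x` has a finite limit at `−∞`. -/
def IsCallFn (R : ℝ → ℝ) : Prop :=
  ConvexOn ℝ Set.univ R ∧ Antitone R ∧
    Tendsto R atTop (nhds 0) ∧ ∃ c : ℝ, Tendsto (fun x => R x + x) atBot (nhds c)

/-- Stop-loss distance, valued in `[0,∞]`. -/
noncomputable def dSL (μ ν : Measure ℝ) : ℝ≥0∞ :=
  ⨆ x : ℝ, ENNReal.ofReal |callFn μ x - callFn ν x|

/-- Lévy distance. -/
noncomputable def dLevy (μ ν : Measure ℝ) : ℝ≥0∞ :=
  sInf (ENNReal.ofReal '' {h : ℝ | 0 < h ∧ ∀ x : ℝ,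
    cdfM μ (x - h) - h ≤ cdfM ν x ∧ cdfM ν x ≤ cdfM μ (x + h) + h})

/-- Prokhorov distance on ℝ. -/
noncomputable def dProk (μ ν : Measure ℝ) : ℝ≥0∞ :=
  sInf (ENNReal.ofReal '' {h : ℝ | 0 < h ∧ ∀ A : Set ℝ, IsClosed A →
    ν A ≤ μ (Metric.cthickening h A) + ENNReal.ofReal h})

/-- Modified Lévy distance with parameter `p`. -/
noncomputable def dLevyMod (p : ℝ) (μ ν : Measure ℝ) : ℝ≥0∞ :=
  sInf (ENNReal.ofReal '' {h : ℝ | 0 < h ∧ ∀ x : ℝ,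
    cdfM μ (x - h) - p ≤ cdfM ν x ∧ cdfM ν x ≤ cdfM μ (x + h) + p})

/-- Modified Prokhorov distance with parameter `p`. -/
noncomputable def dProkMod (p : ℝ) (μ ν : Measure ℝ) : ℝ≥0∞ :=
  sInf (ENNReal.ofReal '' {h : ℝ | 0 < h ∧ ∀ A : Set ℝ, IsClosed A →
    ν A ≤ μ (Metric.cthickening h A) + ENNReal.ofReal p})

/-! ### Right derivatives of convex functions -/

lemma rd_hasDeriv {f : ℝ → ℝ} (hf : ConvexOn ℝ univ f) (x : ℝ) :
    HasDerivWithinAt f (rderiv f x) (Ioi x) x :=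
  hf.hasDerivWithinAt_rightDeriv_of_mem_interior (by simp)

lemma rd_mono {f : ℝ → ℝ} (hf : ConvexOn ℝ univ f) : Monotone (rderiv f) := by
  have h := hf.monotoneOn_rightDeriv
  rw [interior_univ, monotoneOn_univ] at h
  exact h

lemma cvx_cont {f : ℝ → ℝ} (hf : ConvexOn ℝ univ f) : Continuous f :=
  continuousOn_univ.1 (hf.continuousOn isOpen_univ)

lemma rd_le_slope {f : ℝ → ℝ} (hf : ConvexOn ℝ univ f) {x y : ℝ} (hxy : x < y) :
    rderiv f x ≤ slope f x y :=
  hf.rightDeriv_le_slope_of_mem_interior (by simp) (by simp) hxy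

lemma rd_rcont {f : ℝ → ℝ} (hf : ConvexOn ℝ univ f) (x : ℝ) :
    ContinuousWithinAt (rderiv f) (Ici x) x := by
  rw [continuousWithinAt_Ioi_iff_Ici.symm]
  rw [ContinuousWithinAt, tendsto_order]
  constructor
  · intro a ha
    filter_upwards [self_mem_nhdsWithin] with z hz
    exact lt_of_lt_of_le ha (rd_mono hf (le_of_lt hz))
  · intro a ha
    have h1 := rd_hasDeriv hf x
    rw [hasDerivWithinAt_iff_tendsto_slope' (by simp)] at h1
    have h2 := (h1.eventually (eventually_lt_nhds ha)).and self_mem_nhdsWithin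
    obtain ⟨w, hw, hxw⟩ := h2.exists
    have hxw' : x < w := hxw
    have hc : ContinuousAt (fun z => slope f z w) x := by
      simp only [slope_def_field]
      have := (cvx_cont hf).continuousAt (x := x)
      exact ContinuousAt.div (by fun_prop) (by fun_prop) (by linarith)
    have h3 : ∀ᶠ z in nhds x, slope f z w < a := hc.eventually (eventually_lt_nhds hw)
    filter_upwards [nhdsWithin_le_nhds h3, nhdsWithin_le_nhds (eventually_lt_nhds hxw')] with z hz hzw
    exact lt_of_le_of_lt (rd_le_slope hf hzw) hz

lemma cmp_of_rd {f g f' g' : ℝ → ℝ} (hf : Continuous f) (hg : Continuous g)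
    (hf' : ∀ x, HasDerivWithinAt f (f' x) (Ioi x) x)
    (hg' : ∀ x, HasDerivWithinAt g (g' x) (Ioi x) x) (h : ∀ x, f' x ≤ g' x)
    {a b : ℝ} (hab : a ≤ b) : f b - f a ≤ g b - g a := by
  have := image_le_of_deriv_right_le_deriv_boundary (f := fun x => f x - f a) (f' := f')
    (B := fun x => g x - g a) (B' := g') (a := a) (b := b) (by fun_prop)
    (fun x _ => ((hf' x).Ici_of_Ioi).sub_const _) (by simp) (by fun_prop)
    (fun x _ => ((hg' x).Ici_of_Ioi).sub_const _) (fun x _ => h x)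
  exact this (right_mem_Icc.2 hab)

lemma rd_cmp {f g : ℝ → ℝ} {x p q : ℝ} (hf : HasDerivWithinAt f p (Ioi x) x)
    (hg : HasDerivWithinAt g q (Ioi x) x) (h : ∀ y, x ≤ y → f y - f x ≤ g y - g x) : p ≤ q := by
  rw [hasDerivWithinAt_iff_tendsto_slope' (by simp)] at hf hg
  refine le_of_tendsto_of_tendsto hf hg ?_
  filter_upwards [self_mem_nhdsWithin] with z hz
  have hz' : x < z := hz
  simp only [slope_def_field]
  exact div_le_div_of_nonneg_right (h z hz'.le) (by linarith)

lemma rd_ftc {f : ℝ → ℝ} (hf : ConvexOn ℝ univ f) (a b : ℝ) :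
    ∫ s in a..b, rderiv f s = f b - f a :=
  intervalIntegral.integral_eq_sub_of_hasDeriv_right (cvx_cont hf).continuousOn
    (fun x _ => rd_hasDeriv hf x) (rd_mono hf).intervalIntegrable

/-! ### Smallest element -/

lemma hull_aux {P f : ℝ → ℝ} (hP : ConvexOn ℝ univ P)
    (hf : ∀ x y, x ≤ y → P y - P x ≤ f y - f x) {s t a b x : ℝ} (hs : 0 ≤ s) (ht : 0 ≤ t)
    (hst : s + t = 1) (hab : a ≤ b) (hx : x ≤ s * a + t * b) :
    ∃ a' b', s * a' + t * b' = x ∧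
      s * f a' + t * f b' ≤ s * f a + t * f b - (P (s * a + t * b) - P x) := by
  have hs' : s = 1 - t := by linarith
  rcases lt_or_ge x a with hxa | hxa
  · refine ⟨x, x, by rw [← add_mul, hst, one_mul], ?_⟩
    have h1 := hf x a hxa.le
    have h2 := hf x b (by linarith)
    have h3 := hP.2 (mem_univ a) (mem_univ b) hs ht hst
    simp only [smul_eq_mul] at h3
    have h4 := mul_le_mul_of_nonneg_left h1 hs
    have h5 := mul_le_mul_of_nonneg_left h2 ht
    subst hs'
    nlinarith
  · rcases ht.eq_or_lt with rfl | ht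
    · have : s = 1 := by linarith
      subst this
      refine ⟨a, b, by linarith, ?_⟩
      have : x = 1 * a + 0 * b := by linarith
      rw [← this]; simp
    · obtain ⟨b', hb'⟩ : ∃ b', t * b' = x - s * a := ⟨(x - s * a) / t, by field_simp⟩
      refine ⟨a, b', by linarith, ?_⟩
      set y := s * a + t * b with hy
      have e1 : y - x = t * (b - b') := by rw [mul_sub, hb']; ring
      have hbb : b' ≤ b := by
        by_contra hc; push Not at hc
        nlinarith
      have hxb' : x ≤ b' := by
        have : t * x ≤ t * b' := by rw [hb', hs']; nlinarith
        exact le_of_mul_le_mul_left this ht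
      have hyb : y ≤ b := by rw [hy, hs']; nlinarith
      have key : P y + t * P b' ≤ P x + t * P b := by
        rcases (hxb'.trans hbb).eq_or_lt with h | h
        · have h1 : b' = x := by linarith
          have h2 : y = x := by rw [← sub_eq_zero, e1, h1, h]; ring
          rw [h1, h2, h]
        · have hd : 0 < b - x := by linarith
          have J : ∀ w, x ≤ w → w ≤ b → (b - x) * P w ≤ (b - w) * P x + (w - x) * P b := by
            intro w h1 h2
            have := hP.2 (mem_univ x) (mem_univ b) 
              (show 0 ≤ (b - w) / (b - x) from div_nonneg (by linarith) hd.le)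
              (show 0 ≤ (w - x) / (b - x) from div_nonneg (by linarith) hd.le)
              (by field_simp; ring)
            simp only [smul_eq_mul] at this
            have e : (b - w) / (b - x) * x + (w - x) / (b - x) * b = w := by field_simp; ring
            rw [e] at this
            have := mul_le_mul_of_nonneg_left this hd.le
            calc _ ≤ _ := this
              _ = _ := by field_simp
          have h1 := J y hx hyb
          have h2 := mul_le_mul_of_nonneg_left (J b' hxb' hbb) ht.le
          have ey : y = x + t * (b - b') := by linarith
          have : (b - x) * (P y + t * P b') ≤ (b - x) * (P x + t * P b) := by
            calc (b - x) * (P y + t * P b') = (b - x) * P y + t * ((b - x) * P b') := by ring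
              _ ≤ ((b - y) * P x + (y - x) * P b) + t * ((b - b') * P x + (b' - x) * P b) :=
                add_le_add h1 h2
              _ = (b - x) * (P x + t * P b) := by
                generalize P y = Py at *
                rw [ey]; ring
          exact le_of_mul_le_mul_left this hd
      have h6 := mul_le_mul_of_nonneg_left (hf b' b hbb) ht.le
      nlinarith

lemma hull_step {P f : ℝ → ℝ} (hP : ConvexOn ℝ univ P)
    (hf : ∀ x y, x ≤ y → P y - P x ≤ f y - f x) {s t a b x : ℝ} (hs : 0 ≤ s) (ht : 0 ≤ t)
    (hst : s + t = 1) (hx : x ≤ s * a + t * b) :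
    ∃ a' b', s * a' + t * b' = x ∧
      s * f a' + t * f b' ≤ s * f a + t * f b - (P (s * a + t * b) - P x) := by
  rcases le_total a b with hab | hab
  · exact hull_aux hP hf hs ht hst hab hx
  · obtain ⟨a', b', h1, h2⟩ := hull_aux hP hf ht hs (by linarith) hab (x := x) (by linarith)
    refine ⟨b', a', by linarith, ?_⟩
    rw [add_comm (s * a)]
    linarith

lemma cvx_reflect {N : ℝ → ℝ} (hN : ConvexOn ℝ univ N) : ConvexOn ℝ univ (fun x => N (-x)) := by
  refine ⟨convex_univ, fun x _ y _ a b ha hb hab => ?_⟩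
  have := hN.2 (mem_univ (-x)) (mem_univ (-y)) ha hb hab
  simp only [smul_eq_mul] at *
  convert this using 2
  ring

/-- Feasible functions. -/
def Feas (r P N Q : ℝ → ℝ) : Prop :=
  (∀ x, r x ≤ Q x) ∧ (∀ x y, x ≤ y → P y - P x ≤ Q y - Q x) ∧
    (∀ x y, x ≤ y → Q y - Q x ≤ N y - N x)

lemma exists_least {r P N T : ℝ → ℝ} (hr : ConvexOn ℝ univ r) (hP : ConvexOn ℝ univ P)
    (hN : ConvexOn ℝ univ N) (hT : Feas r P N T) :
    ∃ f, ConvexOn ℝ univ f ∧ Feas r P N f ∧ ∀ Q, Feas r P N Q → ∀ x, f x ≤ Q x := by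
  have : Nonempty {Q // Feas r P N Q} := ⟨⟨T, hT⟩⟩
  set f : ℝ → ℝ := fun x => ⨅ Q : {Q // Feas r P N Q}, Q.1 x with hfdef
  have hb : ∀ x, BddBelow (range fun Q : {Q // Feas r P N Q} => Q.1 x) := by
    intro x
    refine ⟨r x, ?_⟩
    rintro _ ⟨Q, rfl⟩
    exact Q.2.1 x
  have hle : ∀ Q, Feas r P N Q → ∀ x, f x ≤ Q x := fun Q hQ x => ciInf_le (hb x) ⟨Q, hQ⟩
  have hfF : Feas r P N f := by
    refine ⟨fun x => le_ciInf fun Q => Q.2.1 x, fun x y hxy => ?_, fun x y hxy => ?_⟩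
    · have : P y - P x + f x ≤ f y :=
        le_ciInf fun Q => by
          have h1 := Q.2.2.1 x y hxy
          have h2 := hle Q.1 Q.2 x
          linarith
      linarith
    · have : f y - (N y - N x) ≤ f x :=
        le_ciInf fun Q => by
          have h1 := Q.2.2.2 x y hxy
          have h2 := hle Q.1 Q.2 y
          linarith
      linarith
  refine ⟨f, ⟨convex_univ, ?_⟩, hfF, hle⟩
  intro a0 _ b0 _ s t hs ht hst
  simp only [smul_eq_mul]
  set E : ℝ → Set ℝ := fun x => {z | ∃ a b, s * a + t * b = x ∧ z = s * f a + t * f b} with hE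
  have hrE : ∀ x, ∀ z ∈ E x, r x ≤ z := by
    rintro x z ⟨a, b, rfl, rfl⟩
    have h1 := hr.2 (mem_univ a) (mem_univ b) hs ht hst
    simp only [smul_eq_mul] at h1
    have h2 := mul_le_mul_of_nonneg_left (hfF.1 a) hs
    have h3 := mul_le_mul_of_nonneg_left (hfF.1 b) ht
    linarith
  have hbE : ∀ x, BddBelow (E x) := fun x => ⟨r x, fun z hz => hrE x z hz⟩
  have hne : ∀ x, (E x).Nonempty := fun x =>
    ⟨_, x, x, by rw [← add_mul, hst, one_mul], rfl⟩
  have hh : Feas r P N (fun x => sInf (E x)) := by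
    refine ⟨fun x => le_csInf (hne x) (hrE x), fun x y hxy => ?_, fun x y hxy => ?_⟩
    · have : P y - P x + sInf (E x) ≤ sInf (E y) := by
        refine le_csInf (hne y) ?_
        rintro z ⟨a, b, rfl, rfl⟩
        obtain ⟨a', b', h1, h2⟩ := hull_step hP hfF.2.1 hs ht hst hxy
        have := csInf_le (hbE x) ⟨a', b', h1, rfl⟩
        linarith
      simp only
      linarith
    · have : sInf (E y) - (N y - N x) ≤ sInf (E x) := by
        refine le_csInf (hne x) ?_
        rintro z ⟨a, b, rfl, rfl⟩
        obtain ⟨a', b', h1, h2⟩ := hull_step (cvx_reflect hN) (f := fun x => f (-x))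
          (fun u v huv => by
            have := hfF.2.2 (-v) (-u) (by linarith)
            linarith) hs ht hst (a := -a) (b := -b) (x := -y) (by linarith)
        have := csInf_le (hbE y) ⟨-a', -b', by linarith, rfl⟩
        have e : -(s * -a + t * -b) = s * a + t * b := by ring
        simp only [neg_neg, e] at h2
        linarith
      simp only
      linarith
  exact (hle _ hh _).trans (csInf_le (hbE _) ⟨a0, b0, rfl, rfl⟩)

/-! ### Call functions -/

lemma call_integrable {μ : Measure ℝ} (hμ : MemM μ) (x : ℝ) :
    Integrable (fun y => max (y - x) 0) μ := by
  have := hμ.1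
  exact (hμ.2.sub (integrable_const x)).pos_part

lemma call_convex {μ : Measure ℝ} (hμ : MemM μ) : ConvexOn ℝ univ (callFn μ) := by
  refine ⟨convex_univ, fun x _ z _ a b ha hb hab => ?_⟩
  simp only [smul_eq_mul, callFn]
  rw [← integral_const_mul, ← integral_const_mul, ← integral_add]
  · refine integral_mono (call_integrable hμ _)
      (((call_integrable hμ _).const_mul _).add ((call_integrable hμ _).const_mul _)) ?_
    intro y
    simp only
    have e : y - (a * x + b * z) = a * (y - x) + b * (y - z) := by
      have : b = 1 - a := by linarith
      subst this; ring
    rw [e]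
    refine max_le (add_le_add ?_ ?_) (by positivity)
    · exact mul_le_mul_of_nonneg_left (le_max_left _ _) ha
    · exact mul_le_mul_of_nonneg_left (le_max_left _ _) hb
  · exact (call_integrable hμ _).const_mul _
  · exact (call_integrable hμ _).const_mul _

lemma call_nonneg (μ : Measure ℝ) (x : ℝ) : 0 ≤ callFn μ x :=
  integral_nonneg fun _ => le_max_right _ _

lemma cdfM_eq {μ : Measure ℝ} (hμ : MemM μ) : cdfM μ = ProbabilityTheory.cdf μ := by
  have := hμ.1
  funext x
  rw [ProbabilityTheory.cdf_eq_real]; rfl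

lemma cdfM_mono {μ : Measure ℝ} (hμ : MemM μ) : Monotone (cdfM μ) := by
  rw [cdfM_eq hμ]; exact ProbabilityTheory.monotone_cdf μ

lemma cdfM_rcont {μ : Measure ℝ} (hμ : MemM μ) (x : ℝ) :
    ContinuousWithinAt (cdfM μ) (Ioi x) x := by
  rw [cdfM_eq hμ]
  exact ((ProbabilityTheory.cdf μ).right_continuous x).mono Ioi_subset_Ici_self

lemma call_ind {μ : Measure ℝ} (hμ : MemM μ) (x c : ℝ) :
    ∫ y, (Ioi x).indicator (fun _ => c) y ∂μ = c * (1 - cdfM μ x) := by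
  have := hμ.1
  rw [integral_indicator measurableSet_Ioi, setIntegral_const, smul_eq_mul, mul_comm]
  congr 1
  have : Ioi x = (Iic x)ᶜ := by simp
  rw [this, probReal_compl_eq_one_sub measurableSet_Iic]
  rfl

lemma call_bounds {μ : Measure ℝ} (hμ : MemM μ) {x z : ℝ} (h : x < z) :
    (z - x) * (cdfM μ x - 1) ≤ callFn μ z - callFn μ x ∧
      callFn μ z - callFn μ x ≤ (z - x) * (cdfM μ z - 1) := by
  have := hμ.1
  have hi : ∀ w c : ℝ, Integrable ((Ioi w).indicator (fun _ => c)) μ := fun w c =>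
    (integrable_const c).indicator measurableSet_Ioi
  have e : callFn μ x - callFn μ z = ∫ y, (max (y - x) 0 - max (y - z) 0) ∂μ :=
    (integral_sub (call_integrable hμ x) (call_integrable hμ z)).symm
  have hd := (call_integrable hμ x).sub (call_integrable hμ z)
  have h1 : callFn μ x - callFn μ z ≤ (z - x) * (1 - cdfM μ x) := by
    rw [e, ← call_ind hμ]
    refine integral_mono hd (hi _ _) ?_
    intro y
    simp only [indicator, mem_Ioi]
    split_ifs with hy
    · rcases le_total y z with h2 | h2
      · rw [max_eq_left (by linarith), max_eq_right (by linarith)]; linarith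
      · rw [max_eq_left (by linarith), max_eq_left (by linarith)]; linarith
    · rw [max_eq_right (by linarith), max_eq_right (by linarith)]; linarith
  have h2 : (z - x) * (1 - cdfM μ z) ≤ callFn μ x - callFn μ z := by
    rw [e, ← call_ind hμ]
    refine integral_mono (hi _ _) hd ?_
    intro y
    simp only [indicator, mem_Ioi]
    split_ifs with hy
    · rw [max_eq_left (by linarith), max_eq_left (by linarith)]; linarith
    · rw [max_eq_right (a := y - z) (by linarith), sub_zero]; exact le_max_right _ _
  constructor <;> linarith

lemma call_hasRD {μ : Measure ℝ} (hμ : MemM μ) (x : ℝ) :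
    HasDerivWithinAt (callFn μ) (cdfM μ x - 1) (Ioi x) x := by
  rw [hasDerivWithinAt_iff_tendsto_slope' (by simp)]
  refine tendsto_of_tendsto_of_tendsto_of_le_of_le' tendsto_const_nhds
    ((cdfM_rcont hμ x).tendsto.sub_const 1) ?_ ?_
  · filter_upwards [self_mem_nhdsWithin] with z hz
    have hz' : x < z := hz
    rw [slope_def_field, le_div_iff₀ (by linarith), mul_comm]
    exact (call_bounds hμ hz').1
  · filter_upwards [self_mem_nhdsWithin] with z hz
    have hz' : x < z := hz
    rw [slope_def_field, div_le_iff₀ (by linarith), mul_comm (cdfM μ z - 1)]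
    exact (call_bounds hμ hz').2

lemma call_rderiv {μ : Measure ℝ} (hμ : MemM μ) (x : ℝ) :
    rderiv (callFn μ) x = cdfM μ x - 1 :=
  (call_hasRD hμ x).derivWithin (uniqueDiffWithinAt_Ioi x)

lemma cdfM_le_one {μ : Measure ℝ} (hμ : MemM μ) (x : ℝ) : cdfM μ x ≤ 1 := by
  rw [cdfM_eq hμ]; exact ProbabilityTheory.cdf_le_one _ _

lemma call_antitone {μ : Measure ℝ} (hμ : MemM μ) : Antitone (callFn μ) := by
  intro x z h
  rcases h.eq_or_lt with rfl | h
  · exact le_rfl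
  · have := (call_bounds hμ h).2
    nlinarith [cdfM_le_one hμ z]

lemma call_atTop {μ : Measure ℝ} (hμ : MemM μ) : Tendsto (callFn μ) atTop (nhds 0) := by
  have := hμ.1
  have h := tendsto_integral_filter_of_dominated_convergence (μ := μ) (l := atTop)
    (F := fun (x : ℝ) (y : ℝ) => max (y - x) 0) (f := fun _ => (0 : ℝ)) (fun y => |y|)
    (Eventually.of_forall fun x => (call_integrable hμ x).aestronglyMeasurable)
    (by
      filter_upwards [eventually_ge_atTop 0] with x hx
      refine Eventually.of_forall fun y => ?_
      rw [Real.norm_of_nonneg (le_max_right _ _)]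
      exact max_le (by linarith [le_abs_self y]) (abs_nonneg y))
    hμ.2.abs
    (Eventually.of_forall fun y => by
      refine tendsto_const_nhds.congr' ?_
      filter_upwards [eventually_ge_atTop y] with x hx
      rw [max_eq_right (by linarith)])
  simp only [integral_zero] at h
  exact h

lemma put_eq {μ : Measure ℝ} (hμ : MemM μ) (x : ℝ) :
    ∫ y, max (x - y) 0 ∂μ = callFn μ x + x - meanM μ := by
  have := hμ.1
  have e : ∀ y : ℝ, max (x - y) 0 = max (y - x) 0 + (x - y) := by
    intro y
    rcases le_total x y with h | h
    · rw [max_eq_right (by linarith), max_eq_left (by linarith)]; ring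
    · rw [max_eq_left (by linarith), max_eq_right (by linarith)]; ring
  simp_rw [e]
  have i1 : Integrable (fun y => x - y) μ := (integrable_const x).sub hμ.2
  rw [integral_add (call_integrable hμ x) i1,
    integral_sub (integrable_const x) hμ.2]
  simp [callFn, meanM]; ring

lemma put_integrable {μ : Measure ℝ} (hμ : MemM μ) (x : ℝ) :
    Integrable (fun y => max (x - y) 0) μ := by
  have := hμ.1
  exact ((integrable_const x).sub hμ.2).pos_part

lemma call_atBot {μ : Measure ℝ} (hμ : MemM μ) :
    Tendsto (fun x => callFn μ x + x) atBot (nhds (meanM μ)) := by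
  have := hμ.1
  have h := tendsto_integral_filter_of_dominated_convergence (μ := μ) (l := atBot)
    (F := fun (x : ℝ) (y : ℝ) => max (x - y) 0) (f := fun _ => (0 : ℝ)) (fun y => |y|)
    (Eventually.of_forall fun x => (put_integrable hμ x).aestronglyMeasurable)
    (by
      filter_upwards [eventually_le_atBot 0] with x hx
      refine Eventually.of_forall fun y => ?_
      rw [Real.norm_of_nonneg (le_max_right _ _)]
      exact max_le (by linarith [neg_abs_le y]) (abs_nonneg y))
    hμ.2.abs
    (Eventually.of_forall fun y => by
      refine tendsto_const_nhds.congr' ?_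
      filter_upwards [eventually_le_atBot y] with x hx
      rw [max_eq_right (by linarith)])
  simp_rw [put_eq hμ] at h
  simpa using h.add_const (meanM μ)

/-! ### Convex order -/

lemma order_call {μ ν : Measure ℝ} (hμ : MemM μ) (hν : MemM ν) (h : ConvexOrder μ ν) (x : ℝ) :
    callFn μ x ≤ callFn ν x := by
  refine h _ ?_ (call_integrable hμ x) (call_integrable hν x)
  have h1 : ConvexOn ℝ univ (fun y : ℝ => y - x) :=
    (convexOn_id convex_univ).sub (concaveOn_const x convex_univ)
  exact h1.sup (convexOn_const 0 convex_univ)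

lemma order_mean {μ ν : Measure ℝ} (hμ : MemM μ) (hν : MemM ν) (h : ConvexOrder μ ν) :
    meanM μ = meanM ν := by
  apply le_antisymm
  · exact h _ (convexOn_id convex_univ) hμ.2 hν.2
  · have := h (fun y => -y) (concaveOn_id convex_univ).neg hμ.2.neg hν.2.neg
    rw [integral_neg, integral_neg] at this
    simpa [meanM] using this

/-- The Stieltjes function of the right derivative. -/
noncomputable def rdS {f : ℝ → ℝ} (hf : ConvexOn ℝ univ f) : StieltjesFunction ℝ where
  toFun := rderiv f
  mono' := rd_mono hf
  right_continuous' := rd_rcont hf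

/-- Kernel in the representation of convex functions. -/
noncomputable def cker (y t : ℝ) : ℝ := if 0 < t then max (y - t) 0 else max (t - y) 0

lemma ker_meas : Measurable (Function.uncurry cker) := by
  unfold cker Function.uncurry
  refine Measurable.ite (measurableSet_lt measurable_const measurable_snd) ?_ ?_ <;> fun_prop

lemma ker_repr {f : ℝ → ℝ} (hf : ConvexOn ℝ univ f) (y : ℝ) :
    ∫⁻ t, ENNReal.ofReal (cker y t) ∂(rdS hf).measure
      = ENNReal.ofReal (f y - f 0 - rderiv f 0 * y) := by
  have hm := rd_mono hf
  rcases le_total 0 y with hy | hy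
  · have e1 : ∫⁻ t, ENNReal.ofReal (cker y t) ∂(rdS hf).measure
        = ∫⁻ t in Ioc 0 y, ENNReal.ofReal (y - t) ∂(rdS hf).measure := by
      rw [← lintegral_indicator measurableSet_Ioc]
      congr 1; funext t
      simp only [indicator, mem_Ioc, cker]
      split_ifs with h1 h2 h2
      · rw [max_eq_left (by linarith)]
      · rw [max_eq_right (by by_contra; apply h2; constructor <;> linarith)]; simp
      · exact absurd h2.1 h1
      · rw [max_eq_right (by linarith)]; simp
    rw [e1, lintegral_eq_lintegral_meas_le]
    rotate_left
    · exact (ae_restrict_mem measurableSet_Ioc).mono fun t ht => by simpa using ht.2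
    · fun_prop
    have e2 : ∀ u ∈ Ioi (0 : ℝ), ((rdS hf).measure.restrict (Ioc 0 y)) {t | u ≤ y - t}
        = ENNReal.ofReal (rderiv f (y - u) - rderiv f 0) := by
      intro u hu
      have hu' : 0 < u := hu
      rw [Measure.restrict_apply (measurableSet_le (by fun_prop) (by fun_prop))]
      have : {t | u ≤ y - t} ∩ Ioc 0 y = Ioc 0 (y - u) := by
        ext t; simp only [mem_inter_iff, mem_ofPred_eq, mem_Ioc]
        constructor
        · rintro ⟨a, b, c⟩; constructor <;> linarith
        · rintro ⟨a, b⟩; refine ⟨?_, ?_, ?_⟩ <;> linarith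
      rw [this, StieltjesFunction.measure_Ioc]; rfl
    rw [setLIntegral_congr_fun measurableSet_Ioi e2]
    have e3 : ∫⁻ u in Ioi (0 : ℝ), ENNReal.ofReal (rderiv f (y - u) - rderiv f 0)
        = ∫⁻ u in Ioc 0 y, ENNReal.ofReal (rderiv f (y - u) - rderiv f 0) := by
      rw [← lintegral_indicator measurableSet_Ioc, ← lintegral_indicator measurableSet_Ioi]
      congr 1; funext u
      simp only [indicator, mem_Ioi, mem_Ioc]
      split_ifs with h1 h2 h2
      · rfl
      · refine ENNReal.ofReal_of_nonpos (sub_nonpos.2 (hm ?_))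
        by_contra; apply h2; constructor <;> linarith
      · exact absurd h2.1 h1
      · rfl
    have hii : IntervalIntegrable (fun u => rderiv f (y - u) - rderiv f 0) volume 0 y := by
      apply AntitoneOn.intervalIntegrable
      intro a _ b _ hab
      exact sub_le_sub_right (hm (by linarith)) _
    rw [e3, ← ofReal_integral_eq_lintegral_ofReal]
    · congr 1
      rw [← intervalIntegral.integral_of_le hy, intervalIntegral.integral_sub,
        intervalIntegral.integral_comp_sub_left (fun u => rderiv f u) y, rd_ftc hf]
      · simp; ring
      · apply AntitoneOn.intervalIntegrable
        intro a _ b _ hab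
        exact hm (by linarith)
      · simp
    · exact (intervalIntegrable_iff_integrableOn_Ioc_of_le hy).1 hii
    · exact (ae_restrict_mem measurableSet_Ioc).mono fun t ht => by
        simpa using hm (by linarith [ht.2])
  · have e1 : ∫⁻ t, ENNReal.ofReal (cker y t) ∂(rdS hf).measure
        = ∫⁻ t in Ioc y 0, ENNReal.ofReal (t - y) ∂(rdS hf).measure := by
      rw [← lintegral_indicator measurableSet_Ioc]
      congr 1; funext t
      simp only [indicator, mem_Ioc, cker]
      split_ifs with h1 h2 h2
      · exact absurd h1 (not_lt.2 h2.2)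
      · rw [max_eq_right (by linarith)]; simp
      · rw [max_eq_left (by linarith)]
      · rw [max_eq_right (by by_contra; apply h2; constructor <;> linarith)]; simp
    rw [e1, lintegral_eq_lintegral_meas_lt]
    rotate_left
    · exact (ae_restrict_mem measurableSet_Ioc).mono fun t ht => by simpa using ht.1.le
    · fun_prop
    have e2 : ∀ u ∈ Ioi (0 : ℝ), ((rdS hf).measure.restrict (Ioc y 0)) {t | u < t - y}
        = ENNReal.ofReal (rderiv f 0 - rderiv f (y + u)) := by
      intro u hu
      have hu' : 0 < u := hu
      rw [Measure.restrict_apply (measurableSet_lt (by fun_prop) (by fun_prop))]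
      have : {t | u < t - y} ∩ Ioc y 0 = Ioc (y + u) 0 := by
        ext t; simp only [mem_inter_iff, mem_ofPred_eq, mem_Ioc]
        constructor
        · rintro ⟨a, b, c⟩; constructor <;> linarith
        · rintro ⟨a, b⟩; refine ⟨?_, ?_, ?_⟩ <;> linarith
      rw [this, StieltjesFunction.measure_Ioc]; rfl
    rw [setLIntegral_congr_fun measurableSet_Ioi e2]
    have e3 : ∫⁻ u in Ioi (0 : ℝ), ENNReal.ofReal (rderiv f 0 - rderiv f (y + u))
        = ∫⁻ u in Ioc 0 (-y), ENNReal.ofReal (rderiv f 0 - rderiv f (y + u)) := by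
      rw [← lintegral_indicator measurableSet_Ioc, ← lintegral_indicator measurableSet_Ioi]
      congr 1; funext u
      simp only [indicator, mem_Ioi, mem_Ioc]
      split_ifs with h1 h2 h2
      · rfl
      · refine ENNReal.ofReal_of_nonpos (sub_nonpos.2 (hm ?_))
        by_contra; apply h2; constructor <;> linarith
      · exact absurd h2.1 h1
      · rfl
    have hii : IntervalIntegrable (fun u => rderiv f 0 - rderiv f (y + u)) volume 0 (-y) := by
      apply AntitoneOn.intervalIntegrable
      intro a _ b _ hab
      exact sub_le_sub_left (hm (by linarith)) _
    have hy' : (0 : ℝ) ≤ -y := by linarith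
    rw [e3, ← ofReal_integral_eq_lintegral_ofReal]
    · congr 1
      rw [← intervalIntegral.integral_of_le hy', intervalIntegral.integral_sub,
        intervalIntegral.integral_comp_add_left (fun u => rderiv f u) y, rd_ftc hf]
      · simp; ring
      · simp
      · apply MonotoneOn.intervalIntegrable
        intro a _ b _ hab
        exact hm (by linarith)
    · exact (intervalIntegrable_iff_integrableOn_Ioc_of_le hy').1 hii
    · exact (ae_restrict_mem measurableSet_Ioc).mono fun t ht => by
        simpa using hm (by linarith [ht.2])

lemma supp_line {f : ℝ → ℝ} (hf : ConvexOn ℝ univ f) (y : ℝ) :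
    0 ≤ f y - f 0 - rderiv f 0 * y := by
  have hm := rd_mono hf
  have hl : ∀ x, HasDerivWithinAt (fun z : ℝ => rderiv f 0 * z) (rderiv f 0) (Ioi x) x := fun x => by
    simpa using ((hasDerivAt_id x).const_mul (rderiv f 0)).hasDerivWithinAt
  have hF := rd_ftc hf 0 y
  rcases le_total 0 y with hy | hy
  · have := intervalIntegral.integral_mono_on (μ := volume) (f := fun _ => rderiv f 0) (g := rderiv f) hy
      intervalIntegrable_const hm.intervalIntegrable (fun x hx => hm hx.1)
    simp at this
    linarith
  · have := intervalIntegral.integral_mono_on (μ := volume) (g := fun _ => rderiv f 0) (f := rderiv f) hy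
      hm.intervalIntegrable intervalIntegrable_const (fun x hx => hm hx.2)
    rw [rd_ftc hf] at this
    simp at this
    linarith

lemma ker_int_eq {μ : Measure ℝ} (hμ : MemM μ) (t : ℝ) :
    ∫⁻ y, ENNReal.ofReal (cker y t) ∂μ
      = ENNReal.ofReal (if 0 < t then callFn μ t else callFn μ t + t - meanM μ) := by
  unfold cker
  split_ifs with h
  · rw [← ofReal_integral_eq_lintegral_ofReal (call_integrable hμ t)
      (Eventually.of_forall fun _ => le_max_right _ _)]
    rfl
  · rw [← ofReal_integral_eq_lintegral_ofReal (put_integrable hμ t)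
      (Eventually.of_forall fun _ => le_max_right _ _), put_eq hμ]

lemma order_of_call {μ ν : Measure ℝ} (hμ : MemM μ) (hν : MemM ν)
    (h : ∀ x, callFn μ x ≤ callFn ν x) (hm : meanM μ = meanM ν) : ConvexOrder μ ν := by
  intro f hf hfμ hfν
  have h1 := hμ.1
  have h2 := hν.1
  have main : ∀ κ : Measure ℝ, MemM κ → Integrable f κ →
      Integrable (fun y => f y - f 0 - rderiv f 0 * y) κ ∧
      ∫ y, (f y - f 0 - rderiv f 0 * y) ∂κ = ∫ y, f y ∂κ - f 0 - rderiv f 0 * meanM κ ∧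
      ENNReal.ofReal (∫ y, (f y - f 0 - rderiv f 0 * y) ∂κ) =
        ∫⁻ t, ∫⁻ y, ENNReal.ofReal (cker y t) ∂κ ∂(rdS hf).measure := by
    intro κ hκ hfκ
    have h3 := hκ.1
    have i1 : Integrable (fun y => f y - f 0) κ := hfκ.sub (integrable_const _)
    have i2 : Integrable (fun y => rderiv f 0 * y) κ := hκ.2.const_mul _
    have i3 : Integrable (fun y => f y - f 0 - rderiv f 0 * y) κ := i1.sub i2
    refine ⟨i3, ?_, ?_⟩
    · rw [integral_sub i1 i2, integral_sub hfκ (integrable_const _), integral_const_mul]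
      simp [meanM]
    · rw [ofReal_integral_eq_lintegral_ofReal i3
        (Eventually.of_forall fun y => supp_line hf y)]
      simp_rw [← ker_repr hf]
      rw [lintegral_lintegral_swap]
      exact (ENNReal.measurable_ofReal.comp ker_meas).aemeasurable
  obtain ⟨a1, a2, a3⟩ := main μ hμ hfμ
  obtain ⟨b1, b2, b3⟩ := main ν hν hfν
  have hle : ENNReal.ofReal (∫ y, (f y - f 0 - rderiv f 0 * y) ∂μ) ≤
      ENNReal.ofReal (∫ y, (f y - f 0 - rderiv f 0 * y) ∂ν) := by
    rw [a3, b3]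
    refine lintegral_mono fun t => ?_
    rw [ker_int_eq hμ, ker_int_eq hν]
    apply ENNReal.ofReal_le_ofReal
    split_ifs
    · exact h t
    · linarith [h t]
  rw [ENNReal.ofReal_le_ofReal_iff (integral_nonneg fun y => supp_line hf y), a2, b2, hm] at hle
  linarith

/-! ### The ball -/

lemma ball_sandwich {μ θ : Measure ℝ} {ε : ℝ} (hμ : MemM μ) (hε : 0 < ε) (h : InBallWinf μ ε θ)
    (x : ℝ) : cdfM μ (x - ε) ≤ cdfM θ x ∧ cdfM θ x ≤ cdfM μ (x + ε) := by
  have hδ : ∀ δ, ε < δ → ∀ x, cdfM μ (x - δ) ≤ cdfM θ x ∧ cdfM θ x ≤ cdfM μ (x + δ) := by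
    intro δ hδ x
    have h1 : Winf μ θ < ENNReal.ofReal δ :=
      lt_of_le_of_lt h.2 ((ENNReal.ofReal_lt_ofReal_iff (by linarith)).2 hδ)
    obtain ⟨_, ⟨η, ⟨hη0, hη⟩, rfl⟩, h2⟩ := sInf_lt_iff.1 h1
    have h3 : η < δ := (ENNReal.ofReal_lt_ofReal_iff (by linarith)).1 h2
    exact ⟨(cdfM_mono hμ (by linarith)).trans (hη x).1, (hη x).2.trans (cdfM_mono hμ (by linarith))⟩
  constructor
  · refine ge_of_tendsto (cdfM_rcont h.1 x).tendsto ?_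
    filter_upwards [self_mem_nhdsWithin] with z hz
    have hz' : x < z := hz
    have := (hδ (ε + (z - x)) (by linarith) z).1
    have e : z - (ε + (z - x)) = x - ε := by ring
    rwa [e] at this
  · refine ge_of_tendsto (cdfM_rcont hμ (x + ε)).tendsto ?_
    filter_upwards [self_mem_nhdsWithin] with z hz
    have hz' : x + ε < z := hz
    have := (hδ (z - x) (by linarith) x).2
    have e : x + (z - x) = z := by ring
    rwa [e] at this

lemma ball_of_sandwich {μ θ : Measure ℝ} {ε : ℝ} (hε : 0 < ε) (hθ : MemM θ)
    (h : ∀ x, cdfM μ (x - ε) ≤ cdfM θ x ∧ cdfM θ x ≤ cdfM μ (x + ε)) : InBallWinf μ ε θ :=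
  ⟨hθ, sInf_le ⟨ε, ⟨hε, h⟩, rfl⟩⟩

lemma shift_convex {f : ℝ → ℝ} (hf : ConvexOn ℝ univ f) (c : ℝ) :
    ConvexOn ℝ univ (fun x => f (x + c)) := by
  refine ⟨convex_univ, fun x _ y _ a b ha hb hab => ?_⟩
  have := hf.2 (mem_univ (x + c)) (mem_univ (y + c)) ha hb hab
  simp only [smul_eq_mul] at *
  convert this using 2
  have : b = 1 - a := by linarith
  subst this; ring

lemma shift_hasRD {f : ℝ → ℝ} {c x p : ℝ} (hf : HasDerivWithinAt f p (Ioi (x + c)) (x + c)) :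
    HasDerivWithinAt (fun x => f (x + c)) p (Ioi x) x := by
  have h1 : HasDerivWithinAt (fun x : ℝ => x + c) 1 (Ioi x) x :=
    ((hasDerivAt_id x).add_const c).hasDerivWithinAt
  have := HasDerivWithinAt.comp x hf h1 (fun y hy => by
    have : x < y := hy
    simpa using this)
  rw [mul_one] at this
  exact this

/-- The feasibility conditions relative to `μ`, `ν`. -/
lemma feas_iff {μ : Measure ℝ} {ε : ℝ} (hμ : MemM μ) (r : ℝ → ℝ) {Q : ℝ → ℝ}
    (hQ : ConvexOn ℝ univ Q) :
    Feas r (fun x => callFn μ (x + (-ε))) (fun x => callFn μ (x + ε)) Q ↔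
      (∀ x, r x ≤ Q x) ∧ ∀ x, rderiv (callFn μ) (x - ε) ≤ rderiv Q x ∧
          rderiv Q x ≤ rderiv (callFn μ) (x + ε) := by
  have hd : ∀ c x, HasDerivWithinAt (fun x => callFn μ (x + c)) (rderiv (callFn μ) (x + c))
      (Ioi x) x := fun c x => shift_hasRD (rd_hasDeriv (call_convex hμ) _)
  have hc : ∀ c, Continuous (fun x => callFn μ (x + c)) := fun c =>
    cvx_cont (shift_convex (call_convex hμ) c)
  constructor
  · rintro ⟨h1, h2, h3⟩
    refine ⟨h1, fun x => ⟨?_, ?_⟩⟩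
    · exact rd_cmp (hd (-ε) x) (rd_hasDeriv hQ x) (fun y hy => h2 x y hy)
    · exact rd_cmp (rd_hasDeriv hQ x) (hd ε x) (fun y hy => h3 x y hy)
  · rintro ⟨h1, h2⟩
    refine ⟨h1, fun x y hxy => ?_, fun x y hxy => ?_⟩
    · exact cmp_of_rd (hc _) (cvx_cont hQ) (hd (-ε)) (rd_hasDeriv hQ) (fun x => (h2 x).1) hxy
    · exact cmp_of_rd (cvx_cont hQ) (hc _) (rd_hasDeriv hQ) (hd ε) (fun x => (h2 x).2) hxy

/-- Finite first moment from the sandwich. -/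
lemma int_of_sandwich {μ θ : Measure ℝ} {ε : ℝ} (hμ : MemM μ) [IsProbabilityMeasure θ]
    (h : ∀ x, cdfM μ (x - ε) ≤ cdfM θ x ∧ cdfM θ x ≤ cdfM μ (x + ε)) :
    Integrable (fun y => y) θ := by
  have := hμ.1
  have hIic : ∀ x, θ (Iic x) ≤ μ (Iic (x + ε)) := fun x =>
    (ENNReal.toReal_le_toReal (measure_ne_top _ _) (measure_ne_top _ _)).1 (h x).2
  have hIic' : ∀ x, μ (Iic (x - ε)) ≤ θ (Iic x) := fun x =>
    (ENNReal.toReal_le_toReal (measure_ne_top _ _) (measure_ne_top _ _)).1 (h x).1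
  have hIoi : ∀ x, θ (Ioi x) ≤ μ (Ioi (x - ε)) := fun x => by
    rw [← compl_Iic, ← compl_Iic, prob_compl_eq_one_sub measurableSet_Iic,
      prob_compl_eq_one_sub measurableSet_Iic]
    exact tsub_le_tsub_left (hIic' x) 1
  have hi : Integrable (fun y => |y| + |ε|) μ := hμ.2.abs.add (integrable_const _)
  have hbd : ∫⁻ y, ENNReal.ofReal |y| ∂θ ≤ 2 * ∫⁻ y, ENNReal.ofReal (|y| + |ε|) ∂μ := by
    rw [lintegral_eq_lintegral_meas_lt θ (Eventually.of_forall fun y => abs_nonneg y) (by fun_prop),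
      lintegral_eq_lintegral_meas_le μ (Eventually.of_forall fun y => by positivity) (by fun_prop),
      ← lintegral_const_mul' _ _ (by simp)]
    refine lintegral_mono fun t => ?_
    simp only
    calc θ {a | t < |a|} ≤ θ (Ioi t ∪ Iic (-t)) := by
          refine measure_mono fun a ha => ?_
          have ha' : t < |a| := ha
          rcases lt_abs.1 ha' with h | h
          · exact Or.inl h
          · refine Or.inr ?_
            show a ≤ -t
            linarith
      _ ≤ θ (Ioi t) + θ (Iic (-t)) := measure_union_le _ _
      _ ≤ μ (Ioi (t - ε)) + μ (Iic (-t + ε)) := add_le_add (hIoi t) (hIic _)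
      _ ≤ μ {a | t ≤ |a| + |ε|} + μ {a | t ≤ |a| + |ε|} := by
          refine add_le_add (measure_mono fun a ha => ?_) (measure_mono fun a ha => ?_)
          · have ha' : t - ε < a := ha
            show t ≤ |a| + |ε|
            linarith [le_abs_self a, le_abs_self ε]
          · have ha' : a ≤ -t + ε := ha
            show t ≤ |a| + |ε|
            linarith [neg_abs_le a, le_abs_self ε]
      _ = 2 * μ {a | t ≤ |a| + |ε|} := (two_mul _).symm
  refine ⟨by fun_prop, ?_⟩
  rw [hasFiniteIntegral_iff_norm]
  simp only [Real.norm_eq_abs]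
  refine lt_of_le_of_lt hbd (ENNReal.mul_lt_top (by simp) ?_)
  have := hi.2
  rw [hasFiniteIntegral_iff_norm] at this
  refine lt_of_le_of_lt (lintegral_mono fun y => ENNReal.ofReal_le_ofReal (Real.le_norm_self _)) this

lemma exists_measure {μ : Measure ℝ} {ε : ℝ} (hμ : MemM μ) {f : ℝ → ℝ}
    (hf : ConvexOn ℝ univ f) (hf0 : Tendsto f atTop (nhds 0))
    (h : ∀ x, rderiv (callFn μ) (x - ε) ≤ rderiv f x ∧
          rderiv f x ≤ rderiv (callFn μ) (x + ε)) :
    ∃ S : Measure ℝ, MemM S ∧ (∀ x, cdfM S x = rderiv f x + 1) ∧ ∀ x, callFn S x = f x := by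
  have := hμ.1
  have hs : ∀ x, cdfM μ (x - ε) ≤ rderiv f x + 1 ∧ rderiv f x + 1 ≤ cdfM μ (x + ε) := by
    intro x
    have := h x
    rw [call_rderiv hμ, call_rderiv hμ] at this
    constructor <;> linarith
  let F : StieltjesFunction ℝ :=
    { toFun := fun x => rderiv f x + 1
      mono' := fun x y hxy => by simpa using rd_mono hf hxy
      right_continuous' := fun x => (rd_rcont hf x).add continuousWithinAt_const }
  have hFx : ∀ x, F x = rderiv f x + 1 := fun x => rfl
  have hbot : Tendsto F atBot (nhds 0) := by
    have t := ProbabilityTheory.tendsto_cdf_atBot μ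
    rw [← cdfM_eq hμ] at t
    refine tendsto_of_tendsto_of_tendsto_of_le_of_le
      (t.comp (tendsto_atBot_add_const_right _ (-ε) tendsto_id))
      (t.comp (tendsto_atBot_add_const_right _ ε tendsto_id)) (fun x => (hs x).1) (fun x => (hs x).2)
  have htop : Tendsto F atTop (nhds 1) := by
    have t := ProbabilityTheory.tendsto_cdf_atTop μ
    rw [← cdfM_eq hμ] at t
    refine tendsto_of_tendsto_of_tendsto_of_le_of_le
      (t.comp (tendsto_atTop_add_const_right _ (-ε) tendsto_id))
      (t.comp (tendsto_atTop_add_const_right _ ε tendsto_id)) (fun x => (hs x).1) (fun x => (hs x).2)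
  have hp : IsProbabilityMeasure F.measure := F.isProbabilityMeasure hbot htop
  have hcdf : ∀ x, cdfM F.measure x = rderiv f x + 1 := by
    intro x
    have h1 := ProbabilityTheory.cdf_measure_stieltjesFunction F hbot htop
    have h2 := ProbabilityTheory.cdf_eq_real F.measure x
    rw [h1] at h2
    exact h2.symm
  have hS : MemM F.measure := ⟨hp, int_of_sandwich (ε := ε) hμ fun x => by rw [hcdf]; exact hs x⟩
  refine ⟨F.measure, hS, hcdf, ?_⟩
  have hrd : ∀ x, HasDerivWithinAt (callFn F.measure) (rderiv f x) (Ioi x) x := fun x => by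
    have := call_hasRD hS x
    rwa [hcdf, add_sub_cancel_right] at this
  have hc1 := cvx_cont (call_convex hS)
  have hc2 := cvx_cont hf
  intro x
  have hconst : ∀ y, x ≤ y → callFn F.measure y - f y = callFn F.measure x - f x := by
    intro y hy
    have h1 := cmp_of_rd hc1 hc2 hrd (rd_hasDeriv hf) (fun _ => le_rfl) hy
    have h2 := cmp_of_rd hc2 hc1 (rd_hasDeriv hf) hrd (fun _ => le_rfl) hy
    linarith
  have h1 : Tendsto (fun y => callFn F.measure y - f y) atTop (nhds (0 - 0)) :=
    (call_atTop hS).sub hf0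
  have h2 : Tendsto (fun y => callFn F.measure y - f y) atTop
      (nhds (callFn F.measure x - f x)) := by
    refine tendsto_const_nhds.congr' ?_
    filter_upwards [eventually_ge_atTop x] with y hy
    exact (hconst y hy).symm
  have := tendsto_nhds_unique h1 h2
  linarith

/-- if `A_μ^ν = {θ ∈ B∞(μ,ε) : ν ≤_c θ}` is nonempty, it contains a least
element in convex order; equivalently there is a pointwise smallest call function `R*`
dominating `R_ν` with `R'_μ(x−ε) ≤ (R*)'(x) ≤ R'_μ(x+ε)`. -/
theorem least_element_A (ε : ℝ) (hε : 0 < ε) (μ ν : Measure ℝ)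
    (hμ : MemM μ) (hν : MemM ν)
    (hA : ∃ θ : Measure ℝ, InBallWinf μ ε θ ∧ ConvexOrder ν θ) :
    (∃ S : Measure ℝ, (InBallWinf μ ε S ∧ ConvexOrder ν S) ∧
      (∀ θ : Measure ℝ, InBallWinf μ ε θ → ConvexOrder ν θ → ConvexOrder S θ)) ∧
    (∃ R : ℝ → ℝ, IsCallFn R ∧ (∀ x : ℝ, callFn ν x ≤ R x) ∧
      (∀ x : ℝ, rderiv (callFn μ) (x - ε) ≤ rderiv R x ∧
        rderiv R x ≤ rderiv (callFn μ) (x + ε)) ∧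
      (∀ Q : ℝ → ℝ, IsCallFn Q → (∀ x : ℝ, callFn ν x ≤ Q x) →
        (∀ x : ℝ, rderiv (callFn μ) (x - ε) ≤ rderiv Q x ∧
          rderiv Q x ≤ rderiv (callFn μ) (x + ε)) →
        ∀ x : ℝ, R x ≤ Q x)) := by
  have hB : ∀ θ : Measure ℝ, InBallWinf μ ε θ → ConvexOrder ν θ →
      Feas (callFn ν) (fun x => callFn μ (x + (-ε))) (fun x => callFn μ (x + ε)) (callFn θ) := by
    intro θ h1 h2
    rw [feas_iff hμ _ (call_convex h1.1)]
    refine ⟨order_call hν h1.1 h2, fun x => ?_⟩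
    rw [call_rderiv hμ, call_rderiv hμ, call_rderiv h1.1]
    have := ball_sandwich hμ hε h1 x
    constructor <;> linarith
  obtain ⟨θ₀, hθ₀, hνθ₀⟩ := hA
  obtain ⟨R, hRc, hRF, hRmin⟩ := exists_least (call_convex hν)
    (shift_convex (call_convex hμ) (-ε)) (shift_convex (call_convex hμ) ε) (hB θ₀ hθ₀ hνθ₀)
  have hRF' := (feas_iff hμ _ hRc).1 hRF
  have hRθ := hRmin _ (hB θ₀ hθ₀ hνθ₀)
  have hR0 : Tendsto R atTop (nhds 0) :=
    tendsto_of_tendsto_of_tendsto_of_le_of_le tendsto_const_nhds (call_atTop hθ₀.1)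
      (fun x => (call_nonneg ν x).trans (hRF.1 x)) hRθ
  have hRbot : Tendsto (fun x => R x + x) atBot (nhds (meanM ν)) := by
    have h1 := call_atBot hθ₀.1
    rw [← order_mean hν hθ₀.1 hνθ₀] at h1
    exact tendsto_of_tendsto_of_tendsto_of_le_of_le (call_atBot hν) h1
      (fun x => by simpa using hRF.1 x) (fun x => by simpa using hRθ x)
  have hRanti : Antitone R := by
    intro x y hxy
    have h1 := hRF.2.2 x y hxy
    have h2 := call_antitone hμ (show x + ε ≤ y + ε by linarith)
    simp only at h1
    linarith
  constructor
  · obtain ⟨S, hS, hScdf, hScall⟩ := exists_measure hμ hRc hR0 hRF'.2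
    have hSm : meanM S = meanM ν := by
      refine tendsto_nhds_unique (call_atBot hS) ?_
      simp_rw [hScall]
      exact hRbot
    refine ⟨S, ⟨ball_of_sandwich hε hS fun x => ?_, ?_⟩, fun θ h1 h2 => ?_⟩
    · have := hRF'.2 x
      rw [call_rderiv hμ, call_rderiv hμ] at this
      rw [hScdf]
      constructor <;> linarith
    · exact order_of_call hν hS (fun x => by rw [hScall]; exact hRF.1 x) hSm.symm
    · refine order_of_call hS h1.1 (fun x => ?_) (hSm.trans (order_mean hν h1.1 h2))
      rw [hScall]
      exact hRmin _ (hB θ h1 h2) x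
  · refine ⟨R, ⟨hRc, hRanti, hR0, _, hRbot⟩, hRF.1, hRF'.2, fun Q hQ h1 h2 => ?_⟩
    exact hRmin Q ((feas_iff hμ _ hQ.1).2 ⟨h1, h2⟩)
end

section
/- Let ε > 0 and μ, ν ∈ M be such that A_μ^ν := { θ ∈ B∞(μ, ε) : ν ≤_c θ } is nonempty, and let R* be the call function of the least element S_ν(μ) of A_μ^ν with respect to convex order. Then R* solves the variational-type inequality min{ R*(x) − R_ν(x), (R*)'(x) − R'_μ(x−ε), R'_μ(x+ε) − (R*)'(x) } = 0 for every x ∈ ℝ. -/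
open MeasureTheory Filter Set
open scoped ENNReal

namespace VI

open ProbabilityTheory Topology

/-- Put function. -/
noncomputable def putFn (μ : Measure ℝ) (x : ℝ) : ℝ := ∫ y, max (x - y) 0 ∂μ

lemma lint_call (P : Measure ℝ) [SFinite P] (x : ℝ) :
    ∫⁻ y, ENNReal.ofReal (y - x) ∂P = ∫⁻ s in Ioi x, P (Ioi s) := by
  have h1 : ∀ y, ENNReal.ofReal (y - x) =
      ∫⁻ s in Ioi x, Set.indicator {q : ℝ × ℝ | q.2 < q.1} (fun _ => (1 : ℝ≥0∞)) (y, s) := by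
    intro y
    have : (fun s => Set.indicator {q : ℝ × ℝ | q.2 < q.1} (fun _ => (1 : ℝ≥0∞)) (y, s)) =
        (Iio y).indicator (fun _ => 1) := by
      ext s; simp [Set.indicator]
    rw [this, lintegral_indicator measurableSet_Iio, lintegral_const,
      Measure.restrict_restrict measurableSet_Iio]
    simp [Iio_inter_Ioi]
  have hm : MeasurableSet {q : ℝ × ℝ | q.2 < q.1} := measurableSet_lt measurable_snd measurable_fst
  simp_rw [h1]
  rw [lintegral_lintegral_swap]
  · refine lintegral_congr fun s => ?_
    have : (fun y => Set.indicator {q : ℝ × ℝ | q.2 < q.1} (fun _ => (1 : ℝ≥0∞)) (y, s)) =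
        (Ioi s).indicator (fun _ => 1) := by
      ext y; simp [Set.indicator]
    rw [this, lintegral_indicator measurableSet_Ioi]
    simp
  · exact ((measurable_const.indicator hm).comp (by fun_prop)).aemeasurable

lemma lint_put (P : Measure ℝ) [SFinite P] (x : ℝ) :
    ∫⁻ y, ENNReal.ofReal (x - y) ∂P = ∫⁻ s in Iic x, P (Iic s) := by
  have h1 : ∀ y, ENNReal.ofReal (x - y) =
      ∫⁻ s in Iic x, Set.indicator {q : ℝ × ℝ | q.1 ≤ q.2} (fun _ => (1 : ℝ≥0∞)) (y, s) := by
    intro y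
    have : (fun s => Set.indicator {q : ℝ × ℝ | q.1 ≤ q.2} (fun _ => (1 : ℝ≥0∞)) (y, s)) =
        (Ici y).indicator (fun _ => 1) := by
      ext s; simp [Set.indicator]
    rw [this, lintegral_indicator measurableSet_Ici, lintegral_const,
      Measure.restrict_restrict measurableSet_Ici]
    simp [Ici_inter_Iic]
  have hm : MeasurableSet {q : ℝ × ℝ | q.1 ≤ q.2} := measurableSet_le measurable_fst measurable_snd
  simp_rw [h1]
  rw [lintegral_lintegral_swap]
  · refine lintegral_congr fun s => ?_
    have : (fun y => Set.indicator {q : ℝ × ℝ | q.1 ≤ q.2} (fun _ => (1 : ℝ≥0∞)) (y, s)) =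
        (Iic s).indicator (fun _ => 1) := by
      ext y; simp [Set.indicator]
    rw [this, lintegral_indicator measurableSet_Iic]
    simp
  · exact ((measurable_const.indicator hm).comp (by fun_prop)).aemeasurable

lemma cdfM_eq (P : Measure ℝ) [IsProbabilityMeasure P] : cdfM P = cdf P := by
  ext x; rw [cdf_eq_real]; rfl

lemma cdfM_mono (P : Measure ℝ) [IsProbabilityMeasure P] : Monotone (cdfM P) := by
  rw [cdfM_eq]; exact monotone_cdf P

lemma meas_Iic (P : Measure ℝ) [IsProbabilityMeasure P] (s : ℝ) :
    P (Iic s) = ENNReal.ofReal (cdfM P s) := by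
  rw [cdfM, ENNReal.ofReal_toReal (measure_ne_top _ _)]

lemma cdfM_nonneg (P : Measure ℝ) (s : ℝ) : 0 ≤ cdfM P s := ENNReal.toReal_nonneg

lemma cdfM_le_one (P : Measure ℝ) [IsProbabilityMeasure P] (s : ℝ) : cdfM P s ≤ 1 := by
  rw [cdfM_eq]; exact cdf_le_one P s

lemma meas_Ioi (P : Measure ℝ) [IsProbabilityMeasure P] (s : ℝ) :
    P (Ioi s) = ENNReal.ofReal (1 - cdfM P s) := by
  rw [← compl_Iic, prob_compl_eq_one_sub measurableSet_Iic, meas_Iic,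
    ENNReal.ofReal_sub _ (cdfM_nonneg _ _), ENNReal.ofReal_one]

lemma int_call {P : Measure ℝ} (hP : MemM P) (x : ℝ) :
    Integrable (fun y => max (y - x) 0) P := by
  have := hP.1
  exact (hP.2.sub (integrable_const x)).pos_part

lemma int_put {P : Measure ℝ} (hP : MemM P) (x : ℝ) :
    Integrable (fun y => max (x - y) 0) P := by
  have := hP.1
  exact ((integrable_const x).sub hP.2).pos_part

lemma ofReal_max0 (a : ℝ) : ENNReal.ofReal (max a 0) = ENNReal.ofReal a := by
  simp

lemma ofReal_call {P : Measure ℝ} (hP : MemM P) (x : ℝ) :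
    ENNReal.ofReal (callFn P x) = ∫⁻ y, ENNReal.ofReal (y - x) ∂P := by
  rw [callFn, ofReal_integral_eq_lintegral_ofReal (int_call hP x)
    (Eventually.of_forall fun _ => le_max_right _ _)]
  simp only [ofReal_max0]

lemma ofReal_put {P : Measure ℝ} (hP : MemM P) (x : ℝ) :
    ENNReal.ofReal (putFn P x) = ∫⁻ y, ENNReal.ofReal (x - y) ∂P := by
  rw [putFn, ofReal_integral_eq_lintegral_ofReal (int_put hP x)
    (Eventually.of_forall fun _ => le_max_right _ _)]
  simp only [ofReal_max0]

lemma call_nonneg (P : Measure ℝ) (x : ℝ) : 0 ≤ callFn P x :=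
  integral_nonneg fun _ => le_max_right _ _

lemma put_nonneg (P : Measure ℝ) (x : ℝ) : 0 ≤ putFn P x :=
  integral_nonneg fun _ => le_max_right _ _

lemma call_sub_put {P : Measure ℝ} (hP : MemM P) (x : ℝ) :
    callFn P x - putFn P x = meanM P - x := by
  have := hP.1
  rw [callFn, putFn, meanM, ← integral_sub (int_call hP x) (int_put hP x)]
  have : ∀ y : ℝ, max (y - x) 0 - max (x - y) 0 = y - x := by
    intro y
    rcases le_total y x with h | h
    · rw [max_eq_right (by linarith), max_eq_left (by linarith)]; ring
    · rw [max_eq_left (by linarith), max_eq_right (by linarith)]; ring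
  simp_rw [this]
  rw [integral_sub hP.2 (integrable_const x)]
  simp

/-- integrability and formula -/
lemma call_formula {P : Measure ℝ} (hP : MemM P) (x : ℝ) :
    IntegrableOn (fun s => 1 - cdfM P s) (Ioi x) ∧ callFn P x = ∫ s in Ioi x, (1 - cdfM P s) := by
  have := hP.1
  have h := ofReal_call hP x
  rw [lint_call] at h
  simp_rw [meas_Ioi] at h
  have hmeas : Measurable (fun s => 1 - cdfM P s) :=
    measurable_const.sub (cdfM_mono P).measurable
  have hnn : 0 ≤ᵐ[volume.restrict (Ioi x)] (fun s => 1 - cdfM P s) :=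
    Eventually.of_forall fun s => sub_nonneg.2 (cdfM_le_one P s)
  constructor
  · refine ⟨hmeas.aestronglyMeasurable, ?_⟩
    rw [hasFiniteIntegral_iff_ofReal hnn, ← h]
    exact ENNReal.ofReal_lt_top
  · rw [integral_eq_lintegral_of_nonneg_ae hnn hmeas.aestronglyMeasurable, ← h,
      ENNReal.toReal_ofReal (call_nonneg _ _)]

lemma put_formula {P : Measure ℝ} (hP : MemM P) (x : ℝ) :
    IntegrableOn (fun s => cdfM P s) (Iic x) ∧ putFn P x = ∫ s in Iic x, cdfM P s := by
  have := hP.1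
  have h := ofReal_put hP x
  rw [lint_put] at h
  simp_rw [meas_Iic] at h
  have hmeas : Measurable (fun s => cdfM P s) := (cdfM_mono P).measurable
  have hnn : 0 ≤ᵐ[volume.restrict (Iic x)] (fun s => cdfM P s) :=
    Eventually.of_forall fun s => cdfM_nonneg P s
  constructor
  · refine ⟨hmeas.aestronglyMeasurable, ?_⟩
    rw [hasFiniteIntegral_iff_ofReal hnn, ← h]
    exact ENNReal.ofReal_lt_top
  · rw [integral_eq_lintegral_of_nonneg_ae hnn hmeas.aestronglyMeasurable, ← h,
      ENNReal.toReal_ofReal (put_nonneg _ _)]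

lemma cdf_ii (P : Measure ℝ) [IsProbabilityMeasure P] (a b : ℝ) :
    IntervalIntegrable (cdfM P) volume a b := (cdfM_mono P).intervalIntegrable

lemma put_sub {P : Measure ℝ} (hP : MemM P) (x y : ℝ) :
    putFn P y - putFn P x = ∫ s in x..y, cdfM P s := by
  rw [(put_formula hP x).2, (put_formula hP y).2]
  exact intervalIntegral.integral_Iic_sub_Iic (put_formula hP x).1 (put_formula hP y).1

lemma call_sub {P : Measure ℝ} (hP : MemM P) (x y : ℝ) :
    callFn P y - callFn P x = ∫ s in x..y, (cdfM P s - 1) := by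
  have := hP.1
  have h1 := call_sub_put hP x
  have h2 := call_sub_put hP y
  rw [intervalIntegral.integral_sub (cdf_ii P x y) (by simp), ← put_sub hP]
  simp
  linarith

lemma cdfM_rc (P : Measure ℝ) [IsProbabilityMeasure P] (x : ℝ) :
    ContinuousWithinAt (cdfM P) (Ici x) x := by
  rw [cdfM_eq]; exact (cdf P).right_continuous x

lemma rderiv_call {P : Measure ℝ} (hP : MemM P) (x : ℝ) :
    rderiv (callFn P) x = cdfM P x - 1 := by
  have := hP.1
  have hii : IntervalIntegrable (fun s => cdfM P s - 1) volume x x := by simp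
  have h : HasDerivWithinAt (fun u => ∫ s in x..u, (cdfM P s - 1)) (cdfM P x - 1) (Ici x) x := by
    refine intervalIntegral.integral_hasDerivWithinAt_right hii (t := Ioi x) ?_ ?_
    · exact ((cdfM_mono P).measurable.sub measurable_const).stronglyMeasurable.stronglyMeasurableAtFilter
    · exact ((cdfM_rc P x).mono Ioi_subset_Ici_self).sub continuousWithinAt_const
  have h2 : callFn P = fun u => callFn P x + ∫ s in x..u, (cdfM P s - 1) := by
    ext u; rw [← call_sub hP]; ring
  rw [rderiv, h2]
  exact ((h.mono Ioi_subset_Ici_self).const_add _).derivWithin (uniqueDiffWithinAt_Ioi x)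

lemma call_cont {P : Measure ℝ} (hP : MemM P) : Continuous (callFn P) := by
  have := hP.1
  have h2 : callFn P = fun u => callFn P 0 + ∫ s in (0:ℝ)..u, (cdfM P s - 1) := by
    ext u; rw [← call_sub hP]; ring
  rw [h2]
  exact continuous_const.add (intervalIntegral.continuous_primitive
    (fun a b => (cdf_ii P a b).sub (by simp)) 0)

lemma call_convex (P : Measure ℝ) (hP : MemM P) : ConvexOn ℝ univ (callFn P) := by
  have := hP.1
  refine ⟨convex_univ, fun x _ y _ a b ha hb hab => ?_⟩
  simp only [callFn, smul_eq_mul]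
  rw [← integral_const_mul, ← integral_const_mul, ← integral_add
    ((int_call hP x).const_mul a) ((int_call hP y).const_mul b)]
  refine integral_mono (int_call hP _) (((int_call hP x).const_mul a).add
    ((int_call hP y).const_mul b)) fun z => ?_
  show max (z - (a * x + b * y)) 0 ≤ a * max (z - x) 0 + b * max (z - y) 0
  have e : z - (a * x + b * y) = a * (z - x) + b * (z - y) := by
    have : b = 1 - a := by linarith
    subst this; ring
  rw [e]
  refine max_le ?_ (by positivity)
  gcongr <;> exact le_max_left _ _


lemma conv_repr {φ : ℝ → ℝ} (hφ : ConvexOn ℝ univ φ) :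
    ∃ G : StieltjesFunction ℝ, ∀ y, φ y - φ 0 = ∫ s in (0:ℝ)..y, G s := by
  set g : ℝ → ℝ := fun x => derivWithin φ (Ioi x) x with hg
  have hmono : Monotone g := by
    have := hφ.monotoneOn_rightDeriv
    rw [interior_univ] at this
    exact monotoneOn_univ.1 this
  have hcont : Continuous φ := by
    have := hφ.continuousOn_interior
    rw [interior_univ] at this
    exact continuousOn_univ.1 this
  refine ⟨hmono.stieltjesFunction, fun y => ?_⟩
  rw [← intervalIntegral.integral_eq_sub_of_hasDeriv_right (f' := g) hcont.continuousOn
    (fun x _ => hφ.hasDerivWithinAt_rightDeriv_of_mem_interior (by simp))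
    hmono.intervalIntegrable]
  apply intervalIntegral.integral_congr_ae
  have hc : ∀ᵐ x ∂(volume : Measure ℝ), x ∉ {x | ¬ ContinuousAt g x} :=
    (hmono.countable_not_continuousAt).ae_notMem _
  filter_upwards [hc] with x hx _
  have hx' : ContinuousAt g x := by simpa using hx
  rw [hmono.stieltjesFunction_eq]
  exact (hx'.continuousWithinAt.rightLim_eq).symm

lemma conv_repr2 (φ : ℝ → ℝ) (G : StieltjesFunction ℝ)
    (hG : ∀ y, φ y - φ 0 = ∫ s in (0:ℝ)..y, G s) (y : ℝ) :
    0 ≤ φ y - φ 0 - G 0 * y ∧ ENNReal.ofReal (φ y - φ 0 - G 0 * y) =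
      ∫⁻ t, ENNReal.ofReal (y - t) ∂(G.measure.restrict (Ioi 0)) +
      ∫⁻ t, ENNReal.ofReal (t - y) ∂(G.measure.restrict (Iic 0)) := by
  have hii : ∀ a b, IntervalIntegrable G volume a b := fun a b => G.mono.intervalIntegrable
  have e1 : φ y - φ 0 - G 0 * y = ∫ s in (0:ℝ)..y, (G s - G 0) := by
    rw [intervalIntegral.integral_sub (hii _ _) (by simp), ← hG]; simp; ring
  rcases le_total 0 y with h | h
  · have z : ∫⁻ t, ENNReal.ofReal (t - y) ∂(G.measure.restrict (Iic 0)) = 0 := by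
      rw [setLIntegral_congr_fun (g := fun _ => 0) measurableSet_Iic]
      · simp
      · intro t ht
        exact ENNReal.ofReal_of_nonpos (by linarith [mem_Iic.1 ht])
    have k : ∀ s, (G.measure.restrict (Ioi 0)) (Iic s) = ENNReal.ofReal (G s - G 0) := by
      intro s
      rw [Measure.restrict_apply measurableSet_Iic, inter_comm, Ioi_inter_Iic, G.measure_Ioc]
    have nn : ∀ s ∈ Ioc 0 y, 0 ≤ G s - G 0 := fun s hs => sub_nonneg.2 (G.mono hs.1.le)
    rw [e1, z, add_zero, lint_put, intervalIntegral.integral_of_le h]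
    refine ⟨setIntegral_nonneg measurableSet_Ioc nn, ?_⟩
    simp_rw [k]
    rw [ofReal_integral_eq_lintegral_ofReal (((hii 0 y).sub (by simp)).1)
      ((ae_restrict_iff' measurableSet_Ioc).2 (Eventually.of_forall nn))]
    rw [← Iic_union_Ioc_eq_Iic h, lintegral_union measurableSet_Ioc
      (Iic_disjoint_Ioc le_rfl)]
    rw [setLIntegral_congr_fun (s := Iic 0) (g := fun _ => 0) measurableSet_Iic]
    · simp
    · intro t ht
      exact ENNReal.ofReal_of_nonpos (by linarith [G.mono (mem_Iic.1 ht)])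
  · have z : ∫⁻ t, ENNReal.ofReal (y - t) ∂(G.measure.restrict (Ioi 0)) = 0 := by
      rw [setLIntegral_congr_fun (g := fun _ => 0) measurableSet_Ioi]
      · simp
      · intro t ht
        exact ENNReal.ofReal_of_nonpos (by linarith [mem_Ioi.1 ht])
    have k : ∀ s, (G.measure.restrict (Iic 0)) (Ioi s) = ENNReal.ofReal (G 0 - G s) := by
      intro s
      rw [Measure.restrict_apply measurableSet_Ioi, Ioi_inter_Iic, G.measure_Ioc]
    have nn : ∀ s ∈ Ioc y 0, 0 ≤ G 0 - G s := fun s hs => sub_nonneg.2 (G.mono hs.2)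
    have e2 : ∫ s in (0:ℝ)..y, (G s - G 0) = ∫ s in y..0, (G 0 - G s) := by
      rw [intervalIntegral.integral_symm, ← intervalIntegral.integral_neg]; simp
    rw [e1, e2, z, zero_add, lint_call, intervalIntegral.integral_of_le h]
    refine ⟨setIntegral_nonneg measurableSet_Ioc nn, ?_⟩
    simp_rw [k]
    rw [ofReal_integral_eq_lintegral_ofReal ((IntervalIntegrable.sub (by simp) (hii y 0)).1)
      ((ae_restrict_iff' measurableSet_Ioc).2 (Eventually.of_forall nn))]
    rw [← Ioc_union_Ioi_eq_Ioi h, lintegral_union measurableSet_Ioi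
      (Ioc_disjoint_Ioi le_rfl)]
    rw [setLIntegral_congr_fun (s := Ioi 0) (g := fun _ => 0) measurableSet_Ioi]
    · simp
    · intro t ht
      exact ENNReal.ofReal_of_nonpos (by linarith [G.mono (mem_Ioi.1 ht).le])

lemma convexOrder_of_call {P Q : Measure ℝ} (hP : MemM P) (hQ : MemM Q)
    (hm : meanM P = meanM Q) (hc : ∀ x, callFn P x ≤ callFn Q x) : ConvexOrder P Q := by
  intro φ hφ hφP hφQ
  have := hP.1
  have := hQ.1
  obtain ⟨G, hG⟩ := conv_repr hφ
  have hr := conv_repr2 φ G hG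
  have hp : ∀ x, putFn P x ≤ putFn Q x := by
    intro x
    linarith [hc x, call_sub_put hP x, call_sub_put hQ x]
  set ψ : ℝ → ℝ := fun y => φ y - φ 0 - G 0 * y with hψ
  have iψ : ∀ {Z : Measure ℝ}, MemM Z → Integrable φ Z →
      Integrable ψ Z ∧ ∫ y, φ y ∂Z = ∫ y, ψ y ∂Z + φ 0 + G 0 * meanM Z := by
    intro Z hZ hφZ
    have := hZ.1
    have i1 : Integrable (fun y => φ y - φ 0) Z := hφZ.sub (integrable_const _)
    have i2 : Integrable (fun y => G 0 * y) Z := hZ.2.const_mul _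
    refine ⟨i1.sub i2, ?_⟩
    rw [hψ, integral_sub i1 i2, integral_sub hφZ (integrable_const _), integral_const_mul]
    simp [meanM]
    ring
  have key : ∀ {Z : Measure ℝ}, MemM Z → ∫⁻ y, ENNReal.ofReal (ψ y) ∂Z =
      ∫⁻ t in Ioi 0, ENNReal.ofReal (callFn Z t) ∂G.measure +
      ∫⁻ t in Iic 0, ENNReal.ofReal (putFn Z t) ∂G.measure := by
    intro Z hZ
    have := hZ.1
    simp_rw [ofReal_call hZ, ofReal_put hZ]
    rw [lintegral_lintegral_swap (μ := G.measure.restrict (Ioi 0)),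
      lintegral_lintegral_swap (μ := G.measure.restrict (Iic 0)), ← lintegral_add_left]
    · exact lintegral_congr fun y => (hr y).2
    · apply Measurable.lintegral_prod_right (f := fun y x : ℝ => ENNReal.ofReal (y - x))
      unfold Function.uncurry
      fun_prop
    · exact Measurable.aemeasurable (by unfold Function.uncurry; fun_prop)
    · exact Measurable.aemeasurable (by unfold Function.uncurry; fun_prop)
  suffices hh : ∫ y, ψ y ∂P ≤ ∫ y, ψ y ∂Q by
    rw [(iψ hP hφP).2, (iψ hQ hφQ).2, hm]
    linarith
  have nnψ : ∀ y, 0 ≤ ψ y := fun y => (hr y).1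
  rw [← ENNReal.ofReal_le_ofReal_iff (integral_nonneg nnψ),
    ofReal_integral_eq_lintegral_ofReal (iψ hP hφP).1 (Eventually.of_forall nnψ),
    ofReal_integral_eq_lintegral_ofReal (iψ hQ hφQ).1 (Eventually.of_forall nnψ),
    key hP, key hQ]
  gcongr
  · exact hc _
  · exact hp _

lemma call_of_convexOrder {P Q : Measure ℝ} (hP : MemM P) (hQ : MemM Q)
    (h : ConvexOrder P Q) : meanM P = meanM Q ∧ ∀ x, callFn P x ≤ callFn Q x := by
  refine ⟨le_antisymm ?_ ?_, fun x => ?_⟩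
  · exact h _ (convexOn_id convex_univ) hP.2 hQ.2
  · have := h (fun y => -y) (concaveOn_id convex_univ).neg hP.2.neg hQ.2.neg
    rw [integral_neg, integral_neg] at this
    exact neg_le_neg_iff.1 this
  · refine h _ ?_ (int_call hP x) (int_call hQ x)
    have h1 : ConvexOn ℝ univ (fun y : ℝ => y - x) :=
      (convexOn_id convex_univ).add (convexOn_const (-x) convex_univ)
    exact h1.sup (convexOn_const 0 convex_univ)

lemma ball_bounds {ε : ℝ} {μ S : Measure ℝ} (hμ : MemM μ) (h : InBallWinf μ ε S) (hε : 0 < ε)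
    (x : ℝ) : cdfM μ (x - ε) ≤ cdfM S x ∧ cdfM S x ≤ cdfM μ (x + ε) := by
  have := hμ.1
  have := h.1.1
  have hb : ∀ δ > 0, ∃ ε' < ε + δ, ∀ x : ℝ,
      cdfM μ (x - ε') ≤ cdfM S x ∧ cdfM S x ≤ cdfM μ (x + ε') := by
    intro δ hδ
    have hlt : Winf μ S < ENNReal.ofReal (ε + δ) :=
      lt_of_le_of_lt h.2 ((ENNReal.ofReal_lt_ofReal_iff (by linarith)).2 (by linarith))
    obtain ⟨_, ⟨e, he, rfl⟩, hlt'⟩ := sInf_lt_iff.1 hlt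
    exact ⟨e, (ENNReal.ofReal_lt_ofReal_iff (by linarith)).1 hlt', he.2⟩
  have tend : ∀ (P : Measure ℝ) [IsProbabilityMeasure P] (z : ℝ),
      Tendsto (cdfM P) (𝓝[>] z) (𝓝 (cdfM P z)) := by
    intro P _ z
    exact (cdfM_rc P z).mono_left (nhdsWithin_mono _ Ioi_subset_Ici_self)
  constructor
  · refine ge_of_tendsto (tend S x) ?_
    filter_upwards [self_mem_nhdsWithin] with y hy
    obtain ⟨e, he, hh⟩ := hb (y - x) (sub_pos.2 hy)
    exact (cdfM_mono μ (by linarith)).trans (hh y).1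
  · refine ge_of_tendsto (tend μ (x + ε)) ?_
    filter_upwards [self_mem_nhdsWithin] with y hy
    obtain ⟨e, he, hh⟩ := hb (y - (x + ε)) (sub_pos.2 hy)
    exact (hh x).2.trans (cdfM_mono μ (by linarith))


lemma ivt_aux {f : ℝ → ℝ} {a b γ₀ c d : ℝ} (hab : a ≤ b) (hγ : 0 < γ₀)
    (hint : IntervalIntegrable f volume a b)
    (hf : ∀ s ∈ Ioc a b, f s ≤ 0) (hac : a ≤ c) (hcd : c < d) (hdb : d ≤ b)
    (hpos : ∀ s ∈ Ioo c d, 0 < f s + γ₀) :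
    ∃ κ₀ > 0, ∀ κ, 0 < κ → κ ≤ κ₀ → ∃ γ, 0 < γ ∧ γ ≤ γ₀ ∧ ∫ s in a..b, max (f s + γ) 0 = κ := by
  set H : ℝ → ℝ := fun γ => ∫ s in a..b, max (f s + γ) 0 with hH
  have hi : ∀ γ, IntervalIntegrable (fun s => max (f s + γ) 0) volume a b := by
    intro γ
    rw [intervalIntegrable_iff] at hint ⊢
    have h1 : IntegrableOn (fun s => f s + γ) (Set.uIoc a b) := hint.add (by simp)
    exact Integrable.pos_part h1
  have hcont : Continuous H := by
    have : LipschitzWith (Real.toNNReal |b - a|) H := by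
      refine LipschitzWith.of_dist_le_mul fun x y => ?_
      rw [Real.dist_eq, hH]
      simp only
      rw [← intervalIntegral.integral_sub (hi x) (hi y), ← Real.norm_eq_abs,
        Real.coe_toNNReal _ (abs_nonneg _), mul_comm]
      refine intervalIntegral.norm_integral_le_of_norm_le_const fun s _ => ?_
      rw [Real.norm_eq_abs, Real.dist_eq]
      refine (abs_max_sub_max_le_abs _ _ _).trans ?_
      simp
    exact this.continuous
  have h0 : H 0 = 0 := by
    rw [hH]
    simp only
    rw [intervalIntegral.integral_congr_ae (g := fun _ => 0)]
    · simp
    · refine Eventually.of_forall fun s hs => ?_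
      rw [uIoc_of_le hab] at hs
      simpa using hf s hs
  have hp : 0 < H γ₀ := by
    have hi' : IntervalIntegrable (fun s => max (f s + γ₀) 0) volume c d := by
      refine (hi γ₀).mono_set ?_
      rw [uIcc_of_le hab, uIcc_of_le hcd.le]
      exact Icc_subset_Icc hac hdb
    have h1 : 0 < ∫ s in c..d, max (f s + γ₀) 0 :=
      intervalIntegral.intervalIntegral_pos_of_pos_on hi'
        (fun s hs => lt_max_of_lt_left (hpos s hs)) hcd
    refine lt_of_lt_of_le h1 ?_
    exact intervalIntegral.integral_mono_interval hac hcd.le hdb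
      (Eventually.of_forall fun s => le_max_right _ _) (hi γ₀)
  refine ⟨H γ₀, hp, fun κ hκ hκ' => ?_⟩
  obtain ⟨γ, hγm, hγe⟩ := intermediate_value_Icc hγ.le hcont.continuousOn
    (show κ ∈ Icc (H 0) (H γ₀) from ⟨by rw [h0]; exact hκ.le, hκ'⟩)
  refine ⟨γ, lt_of_le_of_ne hγm.1 ?_, hγm.2, hγe⟩
  rintro rfl
  rw [h0] at hγe
  exact hκ.ne hγe

/-- the perturbed distribution function -/
lemma exists_theta {S : Measure ℝ} (hS : MemM S) (x₁ u v : ℝ) (hu : 0 < u)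
    (huv : u ≤ v) (hv : v < 1) (hux : u ≤ cdfM S x₁) (hvx : cdfM S x₁ ≤ v) :
    ∃ θ : Measure ℝ, MemM θ ∧ ∀ y, cdfM θ y =
      if y < x₁ then min (cdfM S y) u else max (cdfM S y) v := by
  have := hS.1
  set T : ℝ → ℝ := fun y => if y < x₁ then min (cdfM S y) u else max (cdfM S y) v with hT
  have Tmono : Monotone T := by
    intro y z hyz
    have hm := cdfM_mono S hyz
    simp only [hT]
    split_ifs with h1 h2 h2
    · exact min_le_min hm le_rfl
    · exact (min_le_right _ _).trans (huv.trans (le_max_right _ _))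
    · linarith
    · exact max_le_max hm le_rfl
  have Trc : ∀ x, ContinuousWithinAt T (Ici x) x := by
    intro x
    rcases lt_or_ge x x₁ with h | h
    · have h1 : ContinuousWithinAt (fun y => min (cdfM S y) u) (Ici x) x :=
        (cdfM_rc S x).inf continuousWithinAt_const
      refine h1.congr_of_eventuallyEq ?_ (by simp [hT, h])
      filter_upwards [mem_nhdsWithin_of_mem_nhds (Iio_mem_nhds h)] with y hy
      simp [hT, mem_Iio.1 hy]
    · have h1 : ContinuousWithinAt (fun y => max (cdfM S y) v) (Ici x) x :=
        (cdfM_rc S x).sup continuousWithinAt_const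
      refine h1.congr (fun y hy => ?_) (by simp [hT, not_lt.2 h])
      simp [hT, not_lt.2 (h.trans (mem_Ici.1 hy))]
  have hbot : Tendsto (cdfM S) atBot (𝓝 0) := by rw [cdfM_eq]; exact tendsto_cdf_atBot S
  have htop : Tendsto (cdfM S) atTop (𝓝 1) := by rw [cdfM_eq]; exact tendsto_cdf_atTop S
  have Tbot : Tendsto T atBot (𝓝 0) := by
    refine hbot.congr' ?_
    filter_upwards [eventually_lt_atBot x₁, hbot.eventually_lt_const hu] with y h1 h2
    simp [hT, h1, h2.le]
  have Ttop : Tendsto T atTop (𝓝 1) := by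
    refine htop.congr' ?_
    filter_upwards [eventually_ge_atTop x₁, htop.eventually_const_lt hv] with y h1 h2
    simp [hT, not_lt.2 h1, h2.le]
  set G : StieltjesFunction ℝ := ⟨T, Tmono, Trc⟩ with hG
  have hprob : IsProbabilityMeasure G.measure := G.isProbabilityMeasure Tbot Ttop
  have hcdf : ∀ y, cdfM G.measure y = T y := by
    intro y
    rw [cdfM_eq, cdf_measure_stieltjesFunction G Tbot Ttop]
  refine ⟨G.measure, ⟨hprob, ?_⟩, hcdf⟩
  have c1 : ∫⁻ y, ENNReal.ofReal (y - x₁) ∂G.measure < ⊤ := by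
    refine lt_of_le_of_lt ?_ (ENNReal.ofReal_lt_top (r := callFn S x₁))
    rw [ofReal_call hS, lint_call, lint_call]
    refine setLIntegral_mono' measurableSet_Ioi fun s hs => ?_
    rw [meas_Ioi, meas_Ioi, hcdf]
    apply ENNReal.ofReal_le_ofReal
    have : ¬ s < x₁ := not_lt.2 (mem_Ioi.1 hs).le
    simp only [hT, this, if_false]
    linarith [le_max_left (cdfM S s) v]
  have c2 : ∫⁻ y, ENNReal.ofReal (x₁ - y) ∂G.measure < ⊤ := by
    refine lt_of_le_of_lt ?_ (ENNReal.ofReal_lt_top (r := putFn S x₁))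
    rw [ofReal_put hS, lint_put, lint_put, ← setLIntegral_congr Iio_ae_eq_Iic,
      ← setLIntegral_congr Iio_ae_eq_Iic]
    refine setLIntegral_mono' measurableSet_Iio fun s hs => ?_
    rw [meas_Iic, meas_Iic, hcdf]
    apply ENNReal.ofReal_le_ofReal
    simp only [hT, mem_Iio.1 hs, if_true]
    exact min_le_left _ _
  have i1 : Integrable (fun y => max (y - x₁) 0) G.measure := by
    refine ⟨by fun_prop, ?_⟩
    rw [hasFiniteIntegral_iff_ofReal
      (Eventually.of_forall fun y => le_max_right (y - x₁) 0)]
    simpa only [ofReal_max0] using c1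
  have i2 : Integrable (fun y => max (x₁ - y) 0) G.measure := by
    refine ⟨by fun_prop, ?_⟩
    rw [hasFiniteIntegral_iff_ofReal
      (Eventually.of_forall fun y => le_max_right (x₁ - y) 0)]
    simpa only [ofReal_max0] using c2
  refine ((i1.sub i2).add (integrable_const x₁)).congr (Eventually.of_forall fun y => ?_)
  show max (y - x₁) 0 - max (x₁ - y) 0 + x₁ = y
  rcases le_total y x₁ with h | h
  · rw [max_eq_right (by linarith), max_eq_left (by linarith)]; ring
  · rw [max_eq_left (by linarith), max_eq_right (by linarith)]; ring

lemma right_agree {S θ : Measure ℝ} (hS : MemM S) (hθ : MemM θ) {x₁ u v : ℝ}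
    (hc : ∀ y, cdfM θ y = if y < x₁ then min (cdfM S y) u else max (cdfM S y) v)
    {x : ℝ} (hx : x₁ ≤ x) (hF : v ≤ cdfM S x) : callFn θ x = callFn S x := by
  have := hS.1
  rw [(call_formula hθ x).2, (call_formula hS x).2]
  refine setIntegral_congr_fun measurableSet_Ioi fun s hs => ?_
  have h1 : ¬ s < x₁ := not_lt.2 (hx.trans (mem_Ioi.1 hs).le)
  have h2 : v ≤ cdfM S s := hF.trans (cdfM_mono S (mem_Ioi.1 hs).le)
  simp [hc, h1, h2]

lemma left_agree {S θ : Measure ℝ} (hS : MemM S) (hθ : MemM θ) {x₁ u v : ℝ}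
    (hc : ∀ y, cdfM θ y = if y < x₁ then min (cdfM S y) u else max (cdfM S y) v)
    {x : ℝ} (hx : x ≤ x₁) (hF : ∀ s < x, cdfM S s ≤ u) : putFn θ x = putFn S x := by
  rw [(put_formula hθ x).2, (put_formula hS x).2, ← setIntegral_congr_set Iio_ae_eq_Iic,
    ← setIntegral_congr_set Iio_ae_eq_Iic]
  refine setIntegral_congr_fun measurableSet_Iio fun s hs => ?_
  have h1 : s < x₁ := (mem_Iio.1 hs).trans_le hx
  have h2 := hF s hs
  simp [hc, h1, h2]

lemma conv_chord {f : ℝ → ℝ} (hf : ConvexOn ℝ univ f) {a b x m k : ℝ} (hx : x ∈ Icc a b)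
    (ha : f a ≤ m + k * a) (hb : f b ≤ m + k * b) : f x ≤ m + k * x := by
  have h : ConvexOn ℝ univ (fun t => f t + -(m + k * t)) := by
    refine hf.add ⟨convex_univ, fun x _ y _ a b _ _ hab => le_of_eq ?_⟩
    have : b = 1 - a := by linarith
    subst this
    simp only [smul_eq_mul]; ring
  have := h.le_max_of_mem_Icc (mem_univ a) (mem_univ b) hx
  have h2 : f x + -(m + k * x) ≤ 0 := this.trans (max_le (by linarith) (by linarith))
  linarith

lemma theta_call {S θ ν : Measure ℝ} (hS : MemM S) (hθ : MemM θ) (hν : MemM ν) {x₁ u v : ℝ}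
    (hc : ∀ y, cdfM θ y = if y < x₁ then min (cdfM S y) u else max (cdfM S y) v)
    (hu : 0 < u) (hv : v < 1) (hux : u < cdfM S x₁) (hvx : cdfM S x₁ < v)
    (hm : meanM θ = meanM S)
    (hνS : ∀ x, callFn ν x ≤ callFn S x) (h1 : callFn ν x₁ ≤ callFn θ x₁) (x : ℝ) :
    callFn ν x ≤ callFn θ x := by
  have := hS.1
  have := hθ.1
  have hbot : Tendsto (cdfM S) atBot (𝓝 0) := by rw [cdfM_eq]; exact tendsto_cdf_atBot S
  have htop : Tendsto (cdfM S) atTop (𝓝 1) := by rw [cdfM_eq]; exact tendsto_cdf_atTop S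
  rcases le_total x₁ x with hx | hx
  · set B : Set ℝ := {y | v ≤ cdfM S y} with hB
    have hne : B.Nonempty := by
      obtain ⟨y, hy⟩ := (htop.eventually_const_lt hv).exists
      exact ⟨y, hy.le⟩
    have hlb : ∀ y ∈ B, x₁ ≤ y := by
      intro y hy
      by_contra! hlt
      have := cdfM_mono S hlt.le
      have hy' : v ≤ cdfM S y := hy
      linarith
    have hbdd : BddBelow B := ⟨x₁, hlb⟩
    set b := sInf B with hb
    have hxb : x₁ ≤ b := le_csInf hne hlb
    have hFb : v ≤ cdfM S b := by
      refine ge_of_tendsto ((cdfM_rc S b).mono_left (nhdsWithin_mono _ Ioi_subset_Ici_self)) ?_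
      filter_upwards [self_mem_nhdsWithin] with y hy
      obtain ⟨z, hz, hzy⟩ := exists_lt_of_csInf_lt hne (mem_Ioi.1 hy)
      exact le_trans (show v ≤ cdfM S z from hz) (cdfM_mono S hzy.le)
    rcases le_total b x with hbx | hxb'
    · rw [right_agree hS hθ hc hx (hFb.trans (cdfM_mono S hbx))]
      exact hνS x
    · have hlin : ∀ z ∈ Icc x₁ b, callFn θ z = callFn θ x₁ - (v - 1) * x₁ + (v - 1) * z := by
        intro z hz
        have e := call_sub hθ x₁ z
        rw [intervalIntegral.integral_congr_ae (g := fun _ => v - 1)] at e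
        · simp only [intervalIntegral.integral_const, smul_eq_mul] at e
          linarith
        · have : ∀ᵐ s : ℝ, s ≠ b := by simp [ae_iff]
          filter_upwards [this] with s hsb hs
          rw [uIoc_of_le hz.1] at hs
          have h1 : ¬ s < x₁ := not_lt.2 hs.1.le
          have h2 : cdfM S s ≤ v := by
            by_contra! hlt
            have : b ≤ s := csInf_le hbdd hlt.le
            exact hsb (le_antisymm (hs.2.trans hz.2) this)
          simp [hc, h1, h2]
      rw [hlin x ⟨hx, hxb'⟩]
      refine conv_chord (call_convex ν hν) (a := x₁) (b := b) ⟨hx, hxb'⟩ ?_ ?_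
      · linarith
      · rw [← hlin b ⟨hxb, le_rfl⟩, right_agree hS hθ hc hxb hFb]
        exact hνS b
  · set A : Set ℝ := {y | cdfM S y ≤ u} with hA
    have hne : A.Nonempty := by
      obtain ⟨y, hy⟩ := (hbot.eventually_lt_const hu).exists
      exact ⟨y, hy.le⟩
    have hub : ∀ y ∈ A, y ≤ x₁ := by
      intro y hy
      by_contra! hlt
      have := cdfM_mono S hlt.le
      have hy' : cdfM S y ≤ u := hy
      linarith
    have hbdd : BddAbove A := ⟨x₁, hub⟩
    set a := sSup A with ha
    have hax : a ≤ x₁ := csSup_le hne hub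
    have hFa : ∀ s < a, cdfM S s ≤ u := by
      intro s hs
      obtain ⟨z, hz, hzy⟩ := exists_lt_of_lt_csSup hne hs
      exact (cdfM_mono S hzy.le).trans hz
    have pc : ∀ z, callFn θ z = callFn S z + (putFn θ z - putFn S z) := by
      intro z
      linarith [call_sub_put hθ z, call_sub_put hS z]
    rcases le_total x a with hxa | hxa
    · rw [pc, left_agree hS hθ hc hx (fun s hs => hFa s (hs.trans_le hxa)), sub_self, add_zero]
      exact hνS x
    · have hlin : ∀ z ∈ Icc a x₁, callFn θ z = callFn θ a - (u - 1) * a + (u - 1) * z := by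
        intro z hz
        have e := call_sub hθ a z
        rw [intervalIntegral.integral_congr_ae (g := fun _ => u - 1)] at e
        · simp only [intervalIntegral.integral_const, smul_eq_mul] at e
          linarith
        · have : ∀ᵐ s : ℝ, s ≠ x₁ := by simp [ae_iff]
          filter_upwards [this] with s hsb hs
          rw [uIoc_of_le hz.1] at hs
          have h1 : s < x₁ := lt_of_le_of_ne (hs.2.trans hz.2) hsb
          have h2 : u ≤ cdfM S s := by
            by_contra! hlt
            have : s ≤ a := le_csSup hbdd hlt.le
            linarith [hs.1]
          simp [hc, h1, h2]
      rw [hlin x ⟨hxa, hx⟩]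
      refine conv_chord (call_convex ν hν) (a := a) (b := x₁) ⟨hxa, hx⟩ ?_ ?_
      · rw [← hlin a ⟨le_rfl, hax⟩, pc, left_agree hS hθ hc hax hFa, sub_self, add_zero]
        exact hνS a
      · rw [← hlin x₁ ⟨hax, le_rfl⟩]
        exact h1


lemma exists_good {S : Measure ℝ} (hS : MemM S) {x₁ γ₀ δ : ℝ} (hγ : 0 < γ₀) (hδ : 0 < δ)
    (hcont : ContinuousAt (cdfM S) x₁) (h0 : 0 < cdfM S x₁ - γ₀) (h1 : cdfM S x₁ + γ₀ < 1) :
    ∃ (θ : Measure ℝ) (γ₁ γ₂ : ℝ), MemM θ ∧ (0 < γ₁ ∧ γ₁ ≤ γ₀) ∧ (0 < γ₂ ∧ γ₂ ≤ γ₀) ∧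
      (∀ y, cdfM θ y = if y < x₁ then min (cdfM S y) (cdfM S x₁ - γ₁)
        else max (cdfM S y) (cdfM S x₁ + γ₂)) ∧ meanM θ = meanM S ∧
      callFn θ x₁ < callFn S x₁ ∧ callFn S x₁ - δ ≤ callFn θ x₁ := by
  have := hS.1
  set p := cdfM S x₁ with hp
  have hbot : Tendsto (cdfM S) atBot (𝓝 0) := by rw [cdfM_eq]; exact tendsto_cdf_atBot S
  have htop : Tendsto (cdfM S) atTop (𝓝 1) := by rw [cdfM_eq]; exact tendsto_cdf_atTop S
  obtain ⟨A, hA⟩ := (hbot.eventually_lt_const h0).exists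
  obtain ⟨B, hB⟩ := (htop.eventually_const_lt h1).exists
  have hAx : A < x₁ := by
    by_contra! h
    linarith [cdfM_mono S h]
  have hxB : x₁ < B := by
    by_contra! h
    linarith [cdfM_mono S h]
  have hev : ∀ᶠ y in 𝓝 x₁, p - γ₀ < cdfM S y ∧ cdfM S y < p + γ₀ :=
    (hcont.eventually_const_lt (show p - γ₀ < cdfM S x₁ by linarith)).and
      (hcont.eventually_lt_const (show cdfM S x₁ < p + γ₀ by linarith))
  obtain ⟨η, hη, hball⟩ := Metric.eventually_nhds_iff.1 hev
  have hball' : ∀ y, x₁ - η < y → y < x₁ + η → p - γ₀ < cdfM S y ∧ cdfM S y < p + γ₀ := by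
    intro y h1 h2
    apply hball
    rw [Real.dist_eq, abs_lt]
    constructor <;> linarith
  obtain ⟨κ₁, hκ₁, L⟩ := ivt_aux (f := fun s => cdfM S s - p) (a := A) (b := x₁) (γ₀ := γ₀)
    (c := max A (x₁ - η)) (d := x₁) hAx.le hγ ((cdf_ii S _ _).sub (by simp))
    (fun s hs => by linarith [cdfM_mono S hs.2]) (le_max_left _ _)
    (max_lt hAx (by linarith)) le_rfl
    (fun s hs => by
      linarith [(hball' s ((le_max_right _ _).trans_lt hs.1) (by linarith [hs.2])).1])
  obtain ⟨κ₂, hκ₂, U⟩ := ivt_aux (f := fun s => p - cdfM S s) (a := x₁) (b := B) (γ₀ := γ₀)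
    (c := x₁) (d := min B (x₁ + η)) hxB.le hγ (IntervalIntegrable.sub (by simp) (cdf_ii S _ _))
    (fun s hs => by linarith [cdfM_mono S hs.1.le]) le_rfl
    (lt_min hxB (by linarith)) (min_le_left _ _)
    (fun s hs => by
      linarith [(hball' s (by linarith [hs.1]) (hs.2.trans_le (min_le_right _ _))).2])
  set κ := min δ (min κ₁ κ₂) with hκ
  have hκ0 : 0 < κ := lt_min hδ (lt_min hκ₁ hκ₂)
  obtain ⟨γ₁, hγ₁, hγ₁', e1⟩ := L κ hκ0 ((min_le_right _ _).trans (min_le_left _ _))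
  obtain ⟨γ₂, hγ₂, hγ₂', e2⟩ := U κ hκ0 ((min_le_right _ _).trans (min_le_right _ _))
  obtain ⟨θ, hθ, hc⟩ := exists_theta hS x₁ (p - γ₁) (p + γ₂) (by linarith) (by linarith)
    (by linarith) (by linarith) (by linarith)
  have := hθ.1
  have hcall : callFn θ x₁ = callFn S x₁ - κ := by
    have a1 := call_sub hθ x₁ B
    have a2 := call_sub hS x₁ B
    have a3 := right_agree hS hθ hc hxB.le (by linarith)
    have a4 : ∫ s in x₁..B, max (p - cdfM S s + γ₂) 0 =
        (∫ s in x₁..B, (cdfM θ s - 1)) - ∫ s in x₁..B, (cdfM S s - 1) := by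
      rw [← intervalIntegral.integral_sub ((cdf_ii θ _ _).sub (by simp))
        ((cdf_ii S _ _).sub (by simp))]
      apply intervalIntegral.integral_congr_ae
      refine Eventually.of_forall fun s hs => ?_
      rw [uIoc_of_le hxB.le] at hs
      rw [hc, if_neg (not_lt.2 hs.1.le)]
      rcases le_total (cdfM S s) (p + γ₂) with h | h
      · rw [max_eq_left (by linarith), max_eq_right h]; ring
      · rw [max_eq_right (by linarith), max_eq_left h]; ring
    linarith
  have hput : putFn θ x₁ = putFn S x₁ - κ := by
    have a1 := put_sub hθ A x₁
    have a2 := put_sub hS A x₁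
    have a3 := left_agree hS hθ hc hAx.le (fun s hs => by linarith [cdfM_mono S hs.le])
    have a4 : ∫ s in A..x₁, max (cdfM S s - p + γ₁) 0 =
        (∫ s in A..x₁, cdfM S s) - ∫ s in A..x₁, cdfM θ s := by
      rw [← intervalIntegral.integral_sub (cdf_ii S _ _) (cdf_ii θ _ _)]
      apply intervalIntegral.integral_congr_ae
      have : ∀ᵐ s : ℝ, s ≠ x₁ := by simp [ae_iff]
      filter_upwards [this] with s hsx hs
      rw [uIoc_of_le hAx.le] at hs
      rw [hc, if_pos (lt_of_le_of_ne hs.2 hsx)]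
      rcases le_total (cdfM S s) (p - γ₁) with h | h
      · rw [max_eq_right (by linarith), min_eq_left h]; ring
      · rw [max_eq_left (by linarith), min_eq_right h]; ring
    linarith
  refine ⟨θ, γ₁, γ₂, hθ, ⟨hγ₁, hγ₁'⟩, ⟨hγ₂, hγ₂'⟩, hc, ?_, by linarith, ?_⟩
  · linarith [call_sub_put hθ x₁, call_sub_put hS x₁]
  · have : κ ≤ δ := min_le_left _ _
    linarith

end VI

/-- the call function `R* = R_{S_ν(μ)}` of the least element of `A_μ^ν`
solves the variational-type inequality
`min{R*(x) − R_ν(x), (R*)'(x) − R'_μ(x−ε), R'_μ(x+ε) − (R*)'(x)} = 0`. -/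
theorem variational_inequality (ε : ℝ) (hε : 0 < ε) (μ ν : Measure ℝ)
    (hμ : MemM μ) (hν : MemM ν) (S : Measure ℝ)
    (hS : (InBallWinf μ ε S ∧ ConvexOrder ν S) ∧
      (∀ θ : Measure ℝ, InBallWinf μ ε θ → ConvexOrder ν θ → ConvexOrder S θ)) :
    ∀ x : ℝ,
      min (callFn S x - callFn ν x)
        (min (rderiv (callFn S) x - rderiv (callFn μ) (x - ε))
          (rderiv (callFn μ) (x + ε) - rderiv (callFn S) x)) = 0 := by

  obtain ⟨⟨hball, hνS⟩, hleast⟩ := hS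
  have hSM := hball.1
  have := hSM.1
  have := hμ.1
  have hb := VI.ball_bounds hμ hball hε
  obtain ⟨hmean, hcall⟩ := VI.call_of_convexOrder hν hSM hνS
  intro x
  rw [VI.rderiv_call hSM, VI.rderiv_call hμ, VI.rderiv_call hμ]
  have n1 : 0 ≤ callFn S x - callFn ν x := sub_nonneg.2 (hcall x)
  have n2 : 0 ≤ (cdfM S x - 1) - (cdfM μ (x - ε) - 1) := by linarith [(hb x).1]
  have n3 : 0 ≤ (cdfM μ (x + ε) - 1) - (cdfM S x - 1) := by linarith [(hb x).2]
  by_contra hne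
  have hpos := lt_of_le_of_ne (le_min n1 (le_min n2 n3)) (Ne.symm hne)
  obtain ⟨p1, p23⟩ := lt_min_iff.1 hpos
  obtain ⟨p2, p3⟩ := lt_min_iff.1 p23
  -- move slightly to the right, to a continuity point of the distribution function
  have rc : ∀ (P : Measure ℝ) [IsProbabilityMeasure P] (z : ℝ),
      Tendsto (cdfM P) (nhdsWithin z (Ioi z)) (nhds (cdfM P z)) := fun P _ z =>
    (VI.cdfM_rc P z).mono_left (nhdsWithin_mono _ Ioi_subset_Ici_self)
  have shift : Tendsto (fun y => y - ε) (nhdsWithin x (Ioi x))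
      (nhdsWithin (x - ε) (Ioi (x - ε))) := by
    refine tendsto_nhdsWithin_iff.2 ⟨?_, ?_⟩
    · exact ((continuous_id.sub continuous_const).tendsto x).mono_left nhdsWithin_le_nhds
    · filter_upwards [self_mem_nhdsWithin] with y hy
      exact sub_lt_sub_right (mem_Ioi.1 hy) ε
  have t1 : Tendsto (fun y => callFn S y - callFn ν y) (nhdsWithin x (Ioi x))
      (nhds (callFn S x - callFn ν x)) :=
    (((VI.call_cont hSM).sub (VI.call_cont hν)).tendsto x).mono_left nhdsWithin_le_nhds
  have t2 : Tendsto (fun y => cdfM S y - cdfM μ (y - ε)) (nhdsWithin x (Ioi x))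
      (nhds (cdfM S x - cdfM μ (x - ε))) := (rc S x).sub ((rc μ (x - ε)).comp shift)
  have hev : ∀ᶠ y in nhdsWithin x (Ioi x), 0 < callFn S y - callFn ν y ∧
      0 < cdfM S y - cdfM μ (y - ε) ∧ cdfM S y < cdfM μ (x + ε) ∧ x < y :=
    (t1.eventually_const_lt p1).and ((t2.eventually_const_lt (by linarith)).and
      (((rc S x).eventually_lt_const (by linarith)).and self_mem_nhdsWithin))
  obtain ⟨w, hw, hsub⟩ := mem_nhdsGT_iff_exists_Ioo_subset.1 hev
  have hdense := ((VI.cdfM_mono S).countable_not_continuousAt).dense_compl ℝ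
  obtain ⟨x₁, hx₁, hx₁c⟩ := hdense.exists_mem_open isOpen_Ioo (nonempty_Ioo.2 (mem_Ioi.1 hw))
  have hcont : ContinuousAt (cdfM S) x₁ := by simpa using hx₁
  obtain ⟨q1, q2, q3', hxx⟩ := hsub hx₁c
  have q3 : cdfM S x₁ < cdfM μ (x₁ + ε) :=
    q3'.trans_le (VI.cdfM_mono μ (by linarith))
  set γ₀ := min ((cdfM S x₁ - cdfM μ (x₁ - ε)) / 2) ((cdfM μ (x₁ + ε) - cdfM S x₁) / 2) with hγ₀
  have hγpos : 0 < γ₀ := lt_min (by linarith) (by linarith)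
  have g1 : γ₀ ≤ (cdfM S x₁ - cdfM μ (x₁ - ε)) / 2 := min_le_left _ _
  have g2 : γ₀ ≤ (cdfM μ (x₁ + ε) - cdfM S x₁) / 2 := min_le_right _ _
  have hnn := VI.cdfM_nonneg μ (x₁ - ε)
  have hle1 := VI.cdfM_le_one μ (x₁ + ε)
  obtain ⟨θ, γ₁, γ₂, hθ, ⟨hγ₁, hγ₁'⟩, ⟨hγ₂, hγ₂'⟩, hc, hm, hlt, hge⟩ :=
    VI.exists_good hSM hγpos q1 hcont (by linarith) (by linarith)
  have hθball : InBallWinf μ ε θ := by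
    refine ⟨hθ, sInf_le ⟨ε, ⟨hε, fun y => ?_⟩, rfl⟩⟩
    obtain ⟨b1, b2⟩ := hb y
    rw [hc]
    split_ifs with hy
    · refine ⟨le_min b1 ?_, (min_le_left _ _).trans b2⟩
      have := VI.cdfM_mono μ (show y - ε ≤ x₁ - ε by linarith)
      linarith
    · refine ⟨b1.trans (le_max_left _ _), max_le b2 ?_⟩
      have := VI.cdfM_mono μ (show x₁ + ε ≤ y + ε by linarith)
      linarith
  have hνθ : ConvexOrder ν θ := by
    refine VI.convexOrder_of_call hν hθ (hmean.trans hm.symm) fun z => ?_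
    exact VI.theta_call hSM hθ hν hc (by linarith) (by linarith) (by linarith) (by linarith)
      hm hcall (by linarith) z
  have := (VI.call_of_convexOrder hSM hθ (hleast θ hθball hνθ)).2 x₁
  linarith
end

section
/- Let ε > 0 and let (μ_n)_{n∈ℕ} be a sequence in M with call functions R_n = R_{μ_n}, such that I := ⋂_{n∈ℕ} [Eμ_n − ε, Eμ_n + ε] is nonempty. Then there exists a peacock (ν_n)_{n∈ℕ} with d^SL(μ_n, ν_n) ≤ ε for all n ∈ ℕ if and only if there exists m ∈ I such that max{ (m − x)⁺, R_k(x) − ε } ≤ R_n(x) + ε for all k ≤ n and all x ∈ ℝ. In that case the peacock can be chosen with Eν₁ = m. -/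
open MeasureTheory Filter Set
open scoped ENNReal

namespace SL

/-- The right derivative used for the Stieltjes measure of a convex function. -/
noncomputable def D (f : ℝ → ℝ) (x : ℝ) : ℝ := derivWithin f (Ioi x) x

lemma D_hasDeriv {f : ℝ → ℝ} (hf : ConvexOn ℝ univ f) (x : ℝ) :
    HasDerivWithinAt f (D f x) (Ioi x) x :=
  hf.hasDerivWithinAt_rightDeriv_of_mem_interior (by simp)

lemma D_mono {f : ℝ → ℝ} (hf : ConvexOn ℝ univ f) : Monotone (D f) := by
  intro x y h
  exact hf.monotoneOn_rightDeriv (by simp) (by simp) h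

lemma conv_cont {f : ℝ → ℝ} (hf : ConvexOn ℝ univ f) : Continuous f := by
  have := hf.continuousOn_interior
  rw [interior_univ] at this
  exact continuousOn_univ.mp this

lemma D_le_slope {f : ℝ → ℝ} (hf : ConvexOn ℝ univ f) {x y : ℝ} (h : x < y) :
    D f x ≤ slope f x y :=
  hf.rightDeriv_le_slope_of_mem_interior (by simp) (by simp) h

lemma D_rightcont {f : ℝ → ℝ} (hf : ConvexOn ℝ univ f) (x : ℝ) :
    ContinuousWithinAt (D f) (Ici x) x := by
  apply continuousWithinAt_Ioi_iff_Ici.mp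
  have hs : Tendsto (slope f x) (nhdsWithin x (Ioi x)) (nhds (D f x)) :=
    (hasDerivWithinAt_iff_tendsto_slope' self_notMem_Ioi).mp (D_hasDeriv hf x)
  refine tendsto_order.2 ⟨fun c hc => ?_, fun c hc => ?_⟩
  · filter_upwards [self_mem_nhdsWithin] with y hy
    exact lt_of_lt_of_le hc (D_mono hf (le_of_lt hy))
  · obtain ⟨z, hz, hxz⟩ := ((hs.eventually (gt_mem_nhds hc)).and self_mem_nhdsWithin).exists
    have hxz : x < z := hxz
    have hc2 : ContinuousAt (fun y => slope f y z) x := by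
      simp only [slope_def_field]
      have := conv_cont hf
      apply ContinuousAt.div
      · fun_prop
      · fun_prop
      · exact sub_ne_zero.2 hxz.ne'
    have h1 : ∀ᶠ y in nhdsWithin x (Ioi x), slope f y z < c :=
      nhdsWithin_le_nhds (hc2.eventually (gt_mem_nhds hz))
    have h2 : ∀ᶠ y in nhdsWithin x (Ioi x), y < z :=
      nhdsWithin_le_nhds (gt_mem_nhds hxz)
    filter_upwards [h1, h2] with y hy1 hy2
    exact lt_of_le_of_lt (D_le_slope hf hy2) hy1

/-- Stieltjes function of the right derivative. -/
noncomputable def G (f : ℝ → ℝ) (hf : ConvexOn ℝ univ f) : StieltjesFunction ℝ where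
  toFun := D f
  mono' := D_mono hf
  right_continuous' := D_rightcont hf

lemma G_apply (f : ℝ → ℝ) (hf : ConvexOn ℝ univ f) (x : ℝ) : G f hf x = D f x := rfl

lemma D_int {f : ℝ → ℝ} (hf : ConvexOn ℝ univ f) (a b : ℝ) :
    IntervalIntegrable (D f) volume a b :=
  (D_mono hf).intervalIntegrable

lemma ftc {f : ℝ → ℝ} (hf : ConvexOn ℝ univ f) (a b : ℝ) :
    ∫ t in a..b, D f t = f b - f a :=
  intervalIntegral.integral_eq_sub_of_hasDeriv_right (conv_cont hf).continuousOn
    (fun x _ => D_hasDeriv hf x) (D_int hf a b)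

lemma D_lower {f : ℝ → ℝ} (hf : ConvexOn ℝ univ f) {a b : ℝ} (h : a ≤ b) :
    (b - a) * D f a ≤ f b - f a := by
  rw [← ftc hf]
  have := intervalIntegral.integral_mono_on h (intervalIntegrable_const (c := D f a)) (D_int hf a b)
    (fun x hx => D_mono hf hx.1)
  simpa using this

lemma D_upper {f : ℝ → ℝ} (hf : ConvexOn ℝ univ f) {a b : ℝ} (h : a ≤ b) :
    f b - f a ≤ (b - a) * D f b := by
  rw [← ftc hf]
  have := intervalIntegral.integral_mono_on h (D_int hf a b) (intervalIntegrable_const (c := D f b))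
    (fun x hx => D_mono hf hx.2)
  simpa using this

lemma L1 {f : ℝ → ℝ} (hf : ConvexOn ℝ univ f) {a b : ℝ} (h : a ≤ b) :
    ∫⁻ x in Ioi a, ENNReal.ofReal (b - x) ∂(G f hf).measure
      = ENNReal.ofReal (f b - f a - D f a * (b - a)) := by
  set ρ := (G f hf).measure
  let S : Set (ℝ × ℝ) := {p | a < p.2 ∧ p.2 ≤ p.1 ∧ p.1 ≤ b}
  have hS : MeasurableSet S := by
    apply MeasurableSet.inter
    · exact measurableSet_lt measurable_const measurable_snd
    · apply MeasurableSet.inter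
      · exact measurableSet_le measurable_snd measurable_fst
      · exact measurableSet_le measurable_fst measurable_const
  have e1 := Measure.prod_apply (μ := (volume : Measure ℝ)) (ν := ρ) hS
  have e2 := Measure.prod_apply_symm (μ := (volume : Measure ℝ)) (ν := ρ) hS
  have f1 : ∀ t, ρ (Prod.mk t ⁻¹' S) = (Iic b).indicator (fun t => ENNReal.ofReal (D f t - D f a)) t := by
    intro t
    by_cases ht : t ≤ b
    · rw [indicator_of_mem (by exact ht)]
      have : Prod.mk t ⁻¹' S = Ioc a t := by ext x; simp [S, ht]
      rw [this, StieltjesFunction.measure_Ioc]; rfl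
    · rw [indicator_of_notMem (by simpa using ht)]
      have : Prod.mk t ⁻¹' S = ∅ := by ext x; simp [S, ht]
      rw [this, measure_empty]
  have f2 : ∀ x, volume ((fun t => (t, x)) ⁻¹' S) = (Ioi a).indicator (fun x => ENNReal.ofReal (b - x)) x := by
    intro x
    by_cases hx : a < x
    · rw [indicator_of_mem (by exact hx)]
      have : (fun t => (t, x)) ⁻¹' S = Icc x b := by ext t; simp [S, hx]
      rw [this, Real.volume_Icc]
    · rw [indicator_of_notMem (by simpa using hx)]
      have : (fun t => (t, x)) ⁻¹' S = ∅ := by ext t; simp [S, hx]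
      rw [this, measure_empty]
  simp_rw [f2] at e2
  simp_rw [f1] at e1
  rw [lintegral_indicator measurableSet_Ioi] at e2
  rw [← e2, e1]
  have e3 : ∫⁻ t, (Iic b).indicator (fun t => ENNReal.ofReal (D f t - D f a)) t
      = ∫⁻ t in Ioc a b, ENNReal.ofReal (D f t - D f a) := by
    rw [← lintegral_indicator measurableSet_Ioc]
    congr 1; ext t
    by_cases ht : t ≤ b
    · by_cases ha : a < t
      · rw [indicator_of_mem (by exact ht), indicator_of_mem (by exact ⟨ha, ht⟩)]
      · rw [indicator_of_mem (by exact ht), indicator_of_notMem (fun h => ha h.1)]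
        exact ENNReal.ofReal_of_nonpos (sub_nonpos.2 (D_mono hf (not_lt.1 ha)))
    · rw [indicator_of_notMem (by exact ht), indicator_of_notMem (fun h => ht h.2)]
  have hi : IntervalIntegrable (fun t => D f t - D f a) volume a b :=
    (D_int hf a b).sub intervalIntegrable_const
  rw [e3, ← ofReal_integral_eq_lintegral_ofReal]
  · rw [← intervalIntegral.integral_of_le h, intervalIntegral.integral_sub (D_int hf a b) intervalIntegrable_const, ftc hf]
    simp [mul_comm]
  · exact (intervalIntegrable_iff_integrableOn_Ioc_of_le h).1 hi
  · filter_upwards [ae_restrict_mem measurableSet_Ioc] with t ht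
    exact sub_nonneg.2 (D_mono hf ht.1.le)

lemma L2 {f : ℝ → ℝ} (hf : ConvexOn ℝ univ f) {a b : ℝ} (h : a ≤ b) :
    ∫⁻ x in Iic b, ENNReal.ofReal (x - a) ∂(G f hf).measure
      = ENNReal.ofReal (f a - f b + D f b * (b - a)) := by
  set ρ := (G f hf).measure
  let S : Set (ℝ × ℝ) := {p | a < p.1 ∧ p.1 < p.2 ∧ p.2 ≤ b}
  have hS : MeasurableSet S := by
    apply MeasurableSet.inter
    · exact measurableSet_lt measurable_const measurable_fst
    · apply MeasurableSet.inter
      · exact measurableSet_lt measurable_fst measurable_snd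
      · exact measurableSet_le measurable_snd measurable_const
  have e1 := Measure.prod_apply (μ := (volume : Measure ℝ)) (ν := ρ) hS
  have e2 := Measure.prod_apply_symm (μ := (volume : Measure ℝ)) (ν := ρ) hS
  have f1 : ∀ t, ρ (Prod.mk t ⁻¹' S) = (Ioi a).indicator (fun t => ENNReal.ofReal (D f b - D f t)) t := by
    intro t
    by_cases ht : a < t
    · rw [indicator_of_mem (by exact ht)]
      have : Prod.mk t ⁻¹' S = Ioc t b := by ext x; simp [S, ht]
      rw [this, StieltjesFunction.measure_Ioc]; rfl
    · rw [indicator_of_notMem (by simpa using ht)]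
      have : Prod.mk t ⁻¹' S = ∅ := by ext x; simp [S, ht]
      rw [this, measure_empty]
  have f2 : ∀ x, volume ((fun t => (t, x)) ⁻¹' S) = (Iic b).indicator (fun x => ENNReal.ofReal (x - a)) x := by
    intro x
    by_cases hx : x ≤ b
    · rw [indicator_of_mem (by exact hx)]
      have : (fun t => (t, x)) ⁻¹' S = Ioo a x := by ext t; simp [S, hx]
      rw [this, Real.volume_Ioo]
    · rw [indicator_of_notMem (by simpa using hx)]
      have : (fun t => (t, x)) ⁻¹' S = ∅ := by ext t; simp [S, hx]
      rw [this, measure_empty]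
  simp_rw [f2] at e2
  simp_rw [f1] at e1
  rw [lintegral_indicator measurableSet_Iic] at e2
  rw [← e2, e1]
  have e3 : ∫⁻ t, (Ioi a).indicator (fun t => ENNReal.ofReal (D f b - D f t)) t
      = ∫⁻ t in Ioc a b, ENNReal.ofReal (D f b - D f t) := by
    rw [← lintegral_indicator measurableSet_Ioc]
    congr 1; ext t
    by_cases ha : a < t
    · by_cases ht : t ≤ b
      · rw [indicator_of_mem (by exact ha), indicator_of_mem (by exact ⟨ha, ht⟩)]
      · rw [indicator_of_mem (by exact ha), indicator_of_notMem (fun h => ht h.2)]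
        exact ENNReal.ofReal_of_nonpos (sub_nonpos.2 (D_mono hf (not_le.1 ht).le))
    · rw [indicator_of_notMem (by exact ha), indicator_of_notMem (fun h => ha h.1)]
  have hi : IntervalIntegrable (fun t => D f b - D f t) volume a b :=
    intervalIntegrable_const.sub (D_int hf a b)
  rw [e3, ← ofReal_integral_eq_lintegral_ofReal]
  · rw [← intervalIntegral.integral_of_le h, intervalIntegral.integral_sub intervalIntegrable_const (D_int hf a b), ftc hf]
    congr 1
    simp; ring
  · exact (intervalIntegrable_iff_integrableOn_Ioc_of_le h).1 hi
  · filter_upwards [ae_restrict_mem measurableSet_Ioc] with t ht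
    exact sub_nonneg.2 (D_mono hf ht.2)

/-! Properties of call functions of measures. -/

lemma int_call {μ : Measure ℝ} (h : MemM μ) (x : ℝ) : Integrable (fun y => max (y - x) 0) μ := by
  have := h.1
  exact (h.2.sub (integrable_const x)).pos_part

lemma int_put {μ : Measure ℝ} (h : MemM μ) (x : ℝ) : Integrable (fun y => max (x - y) 0) μ := by
  have := h.1
  exact ((integrable_const x).sub h.2).pos_part

lemma put_eq {μ : Measure ℝ} (h : MemM μ) (x : ℝ) :
    ∫ y, max (x - y) 0 ∂μ = callFn μ x + x - meanM μ := by
  have := h.1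
  have e : ∀ y : ℝ, max (x - y) 0 = max (y - x) 0 + x - y := by
    intro y; rcases le_total x y with h | h
    · rw [max_eq_right (by linarith), max_eq_left (by linarith)]; ring
    · rw [max_eq_left (by linarith), max_eq_right (by linarith)]; ring
  simp_rw [e]
  have hadd : Integrable (fun y => max (y - x) 0 + x) μ := (int_call h x).add (integrable_const x)
  rw [integral_sub hadd h.2,
    integral_add (int_call h x) (integrable_const x)]
  simp [callFn, meanM]

lemma call_add {μ : Measure ℝ} (h : MemM μ) (x : ℝ) :
    callFn μ x + x = ∫ y, max y x ∂μ := by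
  have := h.1
  have e : ∀ y : ℝ, max y x = max (y - x) 0 + x := by
    intro y; rw [max_add, zero_add, sub_add_cancel]
  simp_rw [e]
  rw [integral_add (int_call h x) (integrable_const x)]
  simp [callFn]

lemma call_atBot {μ : Measure ℝ} (h : MemM μ) :
    Tendsto (fun x => callFn μ x + x) atBot (nhds (meanM μ)) := by
  simp_rw [call_add h]
  unfold meanM
  apply tendsto_integral_filter_of_dominated_convergence (fun y => |y|)
  · exact Eventually.of_forall fun x => by fun_prop
  · filter_upwards [eventually_le_atBot 0] with x hx
    refine Eventually.of_forall fun y => ?_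
    rw [Real.norm_eq_abs]
    rcases le_total x y with h | h
    · rw [max_eq_left h]
    · rw [max_eq_right h, abs_of_nonpos hx, abs_of_nonpos (h.trans hx)]; linarith
  · exact h.2.abs
  · refine Eventually.of_forall fun y => ?_
    apply tendsto_const_nhds.congr'
    filter_upwards [eventually_le_atBot y] with x hx
    rw [max_eq_left hx]

lemma call_atTop {μ : Measure ℝ} (h : MemM μ) :
    Tendsto (callFn μ) atTop (nhds 0) := by
  have : Tendsto (fun x => ∫ y, max (y - x) 0 ∂μ) atTop (nhds (∫ _y, (0 : ℝ) ∂μ)) := by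
    apply tendsto_integral_filter_of_dominated_convergence (fun y => |y|)
    · exact Eventually.of_forall fun x => by fun_prop
    · filter_upwards [eventually_ge_atTop 0] with x hx
      refine Eventually.of_forall fun y => ?_
      rw [Real.norm_eq_abs, abs_of_nonneg (le_max_right _ _)]
      exact max_le (by linarith [le_abs_self y]) (abs_nonneg y)
    · exact h.2.abs
    · refine Eventually.of_forall fun y => ?_
      apply tendsto_const_nhds.congr'
      filter_upwards [eventually_ge_atTop y] with x hx
      rw [max_eq_right (by linarith)]
  rw [integral_zero] at this
  exact this

lemma call_anti {μ : Measure ℝ} (h : MemM μ) : Antitone (callFn μ) := by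
  intro a b hab
  exact integral_mono (int_call h b) (int_call h a)
    (fun y => max_le_max (by linarith) le_rfl)

lemma call_convex {μ : Measure ℝ} (h : MemM μ) : ConvexOn ℝ univ (callFn μ) := by
  refine ⟨convex_univ, fun x _ y _ a b ha hb hab => ?_⟩
  simp only [smul_eq_mul, callFn]
  rw [← integral_const_mul, ← integral_const_mul,
    ← integral_add ((int_call h x).const_mul a) ((int_call h y).const_mul b)]
  refine integral_mono (int_call h _) (((int_call h x).const_mul a).add ((int_call h y).const_mul b))
    (fun z => ?_)
  have h1 := mul_le_mul_of_nonneg_left (le_max_left (z - x) 0) ha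
  have h2 := mul_le_mul_of_nonneg_left (le_max_left (z - y) 0) hb
  have h3 := mul_nonneg ha (le_max_right (z - x) 0)
  have h4 := mul_nonneg hb (le_max_right (z - y) 0)
  refine max_le ?_ ?_
  · have : z = a * z + b * z := by rw [← add_mul, hab, one_mul]
    linarith
  · linarith

lemma call_ge {μ : Measure ℝ} (h : MemM μ) (x : ℝ) : max (meanM μ - x) 0 ≤ callFn μ x := by
  have h1 := put_eq h x
  have h2 : 0 ≤ ∫ y, max (x - y) 0 ∂μ := integral_nonneg fun y => le_max_right _ _
  refine max_le (by linarith) (integral_nonneg fun y => le_max_right _ _)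

/-! Convex order from call functions. -/

lemma kernel_eq {f : ℝ → ℝ} (hf : ConvexOn ℝ univ f) (y : ℝ) :
    ENNReal.ofReal (f y - f 0 - D f 0 * y) =
      (∫⁻ x in Ioi 0, ENNReal.ofReal (y - x) ∂(G f hf).measure)
      + ∫⁻ x in Iic 0, ENNReal.ofReal (x - y) ∂(G f hf).measure := by
  rcases le_total 0 y with h | h
  · rw [L1 hf h]
    have : ∫⁻ x in Iic 0, ENNReal.ofReal (x - y) ∂(G f hf).measure = 0 := by
      rw [setLIntegral_congr_fun measurableSet_Iic (g := fun _ => 0)]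
      · simp
      · intro x hx
        have : x ≤ 0 := hx
        exact ENNReal.ofReal_of_nonpos (by linarith)
    rw [this, add_zero, sub_zero]
  · rw [L2 hf h]
    have : ∫⁻ x in Ioi 0, ENNReal.ofReal (y - x) ∂(G f hf).measure = 0 := by
      rw [setLIntegral_congr_fun measurableSet_Ioi (g := fun _ => 0)]
      · simp
      · intro x hx
        have : 0 < x := hx
        exact ENNReal.ofReal_of_nonpos (by linarith)
    rw [this, zero_add]
    congr 1; ring

lemma kernel_int {f : ℝ → ℝ} (hf : ConvexOn ℝ univ f) {μ : Measure ℝ} (h : MemM μ) :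
    ∫⁻ y, ENNReal.ofReal (f y - f 0 - D f 0 * y) ∂μ =
      (∫⁻ x in Ioi 0, ENNReal.ofReal (callFn μ x) ∂(G f hf).measure)
      + ∫⁻ x in Iic 0, ENNReal.ofReal (callFn μ x + x - meanM μ) ∂(G f hf).measure := by
  have := h.1
  simp_rw [kernel_eq hf]
  have m1 : Measurable (fun p : ℝ × ℝ => ENNReal.ofReal (p.1 - p.2)) := by fun_prop
  have m2 : Measurable (fun p : ℝ × ℝ => ENNReal.ofReal (p.2 - p.1)) := by fun_prop
  rw [lintegral_add_left m1.lintegral_prod_right']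
  congr 1
  · refine (lintegral_lintegral_swap (f := fun y x => ENNReal.ofReal (y - x))
      m1.aemeasurable).trans ?_
    refine lintegral_congr fun x => ?_
    unfold callFn
    rw [ofReal_integral_eq_lintegral_ofReal (int_call h x)
      (Eventually.of_forall fun y => le_max_right _ _)]
    simp [ENNReal.ofReal_max]
  · refine (lintegral_lintegral_swap (f := fun y x => ENNReal.ofReal (x - y))
      m2.aemeasurable).trans ?_
    refine lintegral_congr fun x => ?_
    rw [← put_eq h, ofReal_integral_eq_lintegral_ofReal (int_put h x)
      (Eventually.of_forall fun y => le_max_right _ _)]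
    simp [ENNReal.ofReal_max]

lemma convexOrder_of_call {μ ν : Measure ℝ} (hμ : MemM μ) (hν : MemM ν)
    (hm : meanM μ = meanM ν) (hc : ∀ x, callFn μ x ≤ callFn ν x) : ConvexOrder μ ν := by
  intro f hf h1 h2
  have := hμ.1
  have := hν.1
  have key : ∫⁻ y, ENNReal.ofReal (f y - f 0 - D f 0 * y) ∂μ
      ≤ ∫⁻ y, ENNReal.ofReal (f y - f 0 - D f 0 * y) ∂ν := by
    rw [kernel_int hf hμ, kernel_int hf hν, hm]
    gcongr with x x
    · exact hc x
    · exact hc x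
  have nn : ∀ y, 0 ≤ f y - f 0 - D f 0 * y := by
    intro y
    rcases le_total 0 y with h | h
    · have := D_lower hf h
      linarith
    · have := D_upper hf h
      linarith
  have ii : ∀ {μ : Measure ℝ}, MemM μ → Integrable f μ →
      Integrable (fun y => f y - f 0 - D f 0 * y) μ := by
    intro μ h h'
    have := h.1
    exact (h'.sub (integrable_const _)).sub (h.2.const_mul _)
  have ie : ∀ {μ : Measure ℝ}, MemM μ → Integrable f μ →
      ∫ y, (f y - f 0 - D f 0 * y) ∂μ = ∫ y, f y ∂μ - f 0 - D f 0 * meanM μ := by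
    intro μ h h'
    have := h.1
    have hsub : Integrable (fun y => f y - f 0) μ := h'.sub (integrable_const _)
    rw [integral_sub hsub (h.2.const_mul _),
      integral_sub h' (integrable_const _), integral_const_mul]
    simp [meanM]
  rw [← ofReal_integral_eq_lintegral_ofReal (ii hμ h1) (Eventually.of_forall nn),
    ← ofReal_integral_eq_lintegral_ofReal (ii hν h2) (Eventually.of_forall nn),
    ENNReal.ofReal_le_ofReal_iff (integral_nonneg nn), ie hμ h1, ie hν h2, hm] at key
  linarith

/-! Existence of a measure with a given call function. -/

/-- Call function with prescribed mean. -/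
structure IsCall (f : ℝ → ℝ) (m : ℝ) : Prop where
  conv : ConvexOn ℝ univ f
  anti : Antitone f
  top : Tendsto f atTop (nhds 0)
  bot : Tendsto (fun x => f x + x) atBot (nhds m)

lemma D_top {f : ℝ → ℝ} {m : ℝ} (hf : IsCall f m) : Tendsto (D f) atTop (nhds 0) := by
  have l : Tendsto (fun x => f x - f (x - 1)) atTop (nhds (0 - 0)) :=
    hf.top.sub (hf.top.comp (tendsto_atTop_add_const_right _ (-1) tendsto_id))
  have u : Tendsto (fun x => f (x + 1) - f x) atTop (nhds (0 - 0)) :=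
    (hf.top.comp (tendsto_atTop_add_const_right _ 1 tendsto_id)).sub hf.top
  rw [sub_zero] at l u
  refine tendsto_of_tendsto_of_tendsto_of_le_of_le l u (fun x => ?_) (fun x => ?_)
  · have := D_upper hf.conv (a := x - 1) (b := x) (by linarith)
    simpa using this
  · have := D_lower hf.conv (a := x) (b := x + 1) (by linarith)
    simpa using this

lemma D_bot {f : ℝ → ℝ} {m : ℝ} (hf : IsCall f m) : Tendsto (D f) atBot (nhds (-1)) := by
  have l : Tendsto (fun x => (f x + x) - (f (x - 1) + (x - 1)) - 1) atBot (nhds (m - m - 1)) :=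
    (hf.bot.sub (hf.bot.comp (tendsto_atBot_add_const_right _ (-1) tendsto_id))).sub_const 1
  have u : Tendsto (fun x => (f (x + 1) + (x + 1)) - (f x + x) - 1) atBot (nhds (m - m - 1)) :=
    ((hf.bot.comp (tendsto_atBot_add_const_right _ 1 tendsto_id)).sub hf.bot).sub_const 1
  rw [sub_self, zero_sub] at l u
  refine tendsto_of_tendsto_of_tendsto_of_le_of_le l u (fun x => ?_) (fun x => ?_)
  · have := D_upper hf.conv (a := x - 1) (b := x) (by linarith)
    simp only; linarith
  · have := D_lower hf.conv (a := x) (b := x + 1) (by linarith)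
    simp only; linarith

lemma lint_call {f : ℝ → ℝ} {m : ℝ} (hf : IsCall f m) (a : ℝ) :
    ∫⁻ x, ENNReal.ofReal (x - a) ∂(G f hf.conv).measure = ENNReal.ofReal (f a) := by
  set ρ := (G f hf.conv).measure
  have Dn : ∀ t, D f t ≤ 0 := fun t => (D_mono hf.conv).ge_of_tendsto (D_top hf) t
  let S : Set (ℝ × ℝ) := {p | a < p.1 ∧ p.1 < p.2}
  have hS : MeasurableSet S := by
    apply MeasurableSet.inter
    · exact measurableSet_lt measurable_const measurable_fst
    · exact measurableSet_lt measurable_fst measurable_snd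
  have e1 := Measure.prod_apply (μ := (volume : Measure ℝ)) (ν := ρ) hS
  have e2 := Measure.prod_apply_symm (μ := (volume : Measure ℝ)) (ν := ρ) hS
  have f1 : ∀ t, ρ (Prod.mk t ⁻¹' S) = (Ioi a).indicator (fun t => ENNReal.ofReal (- D f t)) t := by
    intro t
    by_cases ht : a < t
    · rw [indicator_of_mem (by exact ht)]
      have : Prod.mk t ⁻¹' S = Ioi t := by ext x; simp [S, ht]
      rw [this, StieltjesFunction.measure_Ioi _ (D_top hf), zero_sub]; rfl
    · rw [indicator_of_notMem (by simpa using ht)]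
      have : Prod.mk t ⁻¹' S = ∅ := by ext x; simp [S, ht]
      rw [this, measure_empty]
  have f2 : ∀ x, volume ((fun t => (t, x)) ⁻¹' S) = ENNReal.ofReal (x - a) := by
    intro x
    have : (fun t => (t, x)) ⁻¹' S = Ioo a x := by ext t; simp [S]
    rw [this, Real.volume_Ioo]
  simp_rw [f2] at e2
  simp_rw [f1] at e1
  rw [lintegral_indicator measurableSet_Ioi] at e1
  rw [← e2, e1]
  have hI : ∀ b, ∫ t in a..b, -D f t = f a - f b := by
    intro b; rw [intervalIntegral.integral_neg, ftc hf.conv]; ring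
  have lim : Tendsto (fun b => ∫ t in a..b, -D f t) atTop (nhds (f a)) := by
    simp_rw [hI]
    simpa using hf.top.const_sub (f a)
  have hint : IntegrableOn (fun t => - D f t) (Ioi a) := by
    apply integrableOn_Ioi_of_intervalIntegral_norm_tendsto (f a) a
      (fun b => ((D_int hf.conv a b).neg).1) tendsto_id
    refine lim.congr fun b => ?_
    congr 1; ext t
    exact (abs_of_nonneg (neg_nonneg.2 (Dn t))).symm
  have hv := tendsto_nhds_unique lim (intervalIntegral_tendsto_integral_Ioi a hint tendsto_id)
  rw [hv, ofReal_integral_eq_lintegral_ofReal hint]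
  exact Eventually.of_forall fun t => neg_nonneg.2 (Dn t)

lemma exists_measure {f : ℝ → ℝ} {m : ℝ} (hf : IsCall f m) :
    ∃ ν : Measure ℝ, MemM ν ∧ (∀ x, callFn ν x = f x) ∧ meanM ν = m := by
  set ν := (G f hf.conv).measure with hνdef
  have f0 : ∀ x, 0 ≤ f x := fun x => hf.anti.le_of_tendsto hf.top x
  have hp : IsProbabilityMeasure ν := by
    constructor
    rw [hνdef, StieltjesFunction.measure_univ _ (D_bot hf) (D_top hf)]
    norm_num
  have hl : ∀ a, ∫⁻ x, ENNReal.ofReal (max (x - a) 0) ∂ν = ENNReal.ofReal (f a) := by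
    intro a; rw [← lint_call hf a]; simp [ENNReal.ofReal_max, hνdef]
  have hi : ∀ a, Integrable (fun x => max (x - a) 0) ν := by
    intro a
    refine ⟨by fun_prop, ?_⟩
    have h0 : ∀ x : ℝ, 0 ≤ max (x - a) 0 := fun x => le_max_right _ _
    rw [hasFiniteIntegral_iff_ofReal (Eventually.of_forall h0), hl]
    exact ENNReal.ofReal_lt_top
  have hc : ∀ x, callFn ν x = f x := by
    intro x
    have h0 : ∀ y : ℝ, 0 ≤ max (y - x) 0 := fun x => le_max_right _ _
    rw [callFn, integral_eq_lintegral_of_nonneg_ae (Eventually.of_forall h0)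
      (hi x).1, hl, ENNReal.toReal_ofReal (f0 x)]
  have hneg : Integrable (fun y : ℝ => max (-y) 0) ν := by
    refine ⟨by fun_prop, ?_⟩
    have h0 : ∀ x : ℝ, 0 ≤ max (-x) 0 := fun x => le_max_right _ _
    rw [hasFiniteIntegral_iff_ofReal (Eventually.of_forall h0)]
    have hmono : Antitone (fun x => -(f x + x)) := by
      intro x y hxy
      have := D_lower hf.conv hxy
      have h1 : -1 ≤ D f x := (D_mono hf.conv).le_of_tendsto (D_bot hf) x
      have := mul_le_mul_of_nonneg_left h1 (sub_nonneg.2 hxy)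
      simp only; linarith
    have hge : ∀ x, m ≤ f x + x := by
      intro x
      have hm : Monotone (fun x => f x + x) := fun x y h => by simpa using neg_le_neg (hmono h)
      exact hm.le_of_tendsto hf.bot x
    have bound : ∀ n : ℕ, ∫⁻ y, ENNReal.ofReal (min (max (-y) 0) n) ∂ν
        ≤ ENNReal.ofReal (f 0 - m) := by
      intro n
      have hn : (0 : ℝ) ≤ n := n.cast_nonneg
      have e : ∀ y : ℝ, min (max (-y) 0) n = max (y - 0) 0 - max (y - (-n)) 0 + n := by
        intro y
        rcases le_total 0 y with h | h
        · rw [max_eq_right (by linarith : -y ≤ 0), min_eq_left hn,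
            max_eq_left (by linarith : (0 : ℝ) ≤ y - 0), max_eq_left (by linarith)]; ring
        · rw [max_eq_left (by linarith : 0 ≤ -y), max_eq_right (by linarith : y - 0 ≤ 0)]
          rcases le_total (-y) n with h' | h'
          · rw [min_eq_left h', max_eq_left (by linarith)]; ring
          · rw [min_eq_right h', max_eq_right (by linarith)]; ring
      have hI : Integrable (fun y : ℝ => max (y - 0) 0 - max (y - (-n)) 0 + n) ν :=
        ((hi 0).sub (hi (-n))).add (integrable_const _)
      have h0 : ∀ y : ℝ, 0 ≤ max (y - 0) 0 - max (y - (-n)) 0 + n := by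
        intro y; rw [← e]; exact le_min (le_max_right _ _) hn
      simp_rw [e]
      have hsub : Integrable (fun y : ℝ => max (y - 0) 0 - max (y - (-n)) 0) ν :=
        (hi 0).sub (hi (-n))
      rw [← ofReal_integral_eq_lintegral_ofReal hI (Eventually.of_forall h0),
        integral_add hsub (integrable_const _), integral_sub (hi 0) (hi (-n))]
      apply ENNReal.ofReal_le_ofReal
      have h1 := hc 0
      have h2 := hc (-n)
      unfold callFn at h1 h2
      rw [h1, h2]
      simp
      linarith [hge (-n)]
    have mc : Tendsto (fun n : ℕ => ∫⁻ y, ENNReal.ofReal (min (max (-y) 0) n) ∂ν) atTop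
        (nhds (∫⁻ y, ENNReal.ofReal (max (-y) 0) ∂ν)) := by
      apply lintegral_tendsto_of_tendsto_of_monotone
      · intro n; fun_prop
      · refine Eventually.of_forall fun y i j hij => ?_
        apply ENNReal.ofReal_le_ofReal
        exact min_le_min le_rfl (by exact_mod_cast hij)
      · refine Eventually.of_forall fun y => ?_
        apply tendsto_const_nhds.congr'
        filter_upwards [eventually_ge_atTop ⌈max (-y) 0⌉₊] with n hn
        rw [min_eq_left (Nat.ceil_le.1 hn)]
    exact lt_of_le_of_lt (le_of_tendsto' mc bound) ENNReal.ofReal_lt_top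
  have hM : MemM ν := by
    refine ⟨hp, ((hi 0).sub hneg).congr (Eventually.of_forall fun y => ?_)⟩
    simp only [Pi.sub_apply, sub_zero]
    rcases le_total 0 y with h | h
    · rw [max_eq_left h, max_eq_right (by linarith)]; ring
    · rw [max_eq_right h, max_eq_left (by linarith)]; ring
  refine ⟨ν, hM, hc, ?_⟩
  have := call_atBot hM
  simp_rw [hc] at this
  exact tendsto_nhds_unique this hf.bot

/-! The running maximum. -/

/-- Running maximum of the minimal call functions. -/
noncomputable def C (μ : ℕ → Measure ℝ) (m ε : ℝ) : ℕ → ℝ → ℝ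
  | 0 => (fun x => max (m - x) 0) ⊔ (fun x => callFn (μ 0) x - ε)
  | n + 1 => C μ m ε n ⊔ (fun x => callFn (μ (n + 1)) x - ε)

lemma isCall_base (m : ℝ) : IsCall (fun x => max (m - x) 0) m := by
  refine ⟨?_, ?_, ?_, ?_⟩
  · refine ConvexOn.sup (f := fun x => m - x) (g := fun _ => 0) ?_ (convexOn_const 0 convex_univ)
    refine ⟨convex_univ, fun x _ y _ a b _ _ hab => le_of_eq ?_⟩
    simp only [smul_eq_mul]
    have : m = a * m + b * m := by rw [← add_mul, hab, one_mul]
    linarith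
  · intro x y h
    exact max_le_max (by linarith) le_rfl
  · apply tendsto_const_nhds.congr'
    filter_upwards [eventually_ge_atTop m] with x hx
    rw [max_eq_right (by linarith)]
  · apply tendsto_const_nhds.congr'
    filter_upwards [eventually_le_atBot m] with x hx
    rw [max_eq_left (by linarith)]; ring

lemma isCall_sup {f : ℝ → ℝ} {m ε : ℝ} (hε : 0 < ε) (hf : IsCall f m) {μ : Measure ℝ}
    (h : MemM μ) (hm : meanM μ - ε ≤ m) : IsCall (f ⊔ fun x => callFn μ x - ε) m := by
  refine ⟨?_, ?_, ?_, ?_⟩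
  · refine hf.conv.sup ?_
    have := (call_convex h).add (convexOn_const (-ε) convex_univ)
    exact this
  · intro x y hxy
    exact max_le_max (hf.anti hxy) (sub_le_sub_right (call_anti h hxy) _)
  · have := hf.top.max ((call_atTop h).sub_const ε)
    rwa [max_eq_left (by linarith)] at this
  · have := hf.bot.max ((call_atBot h).sub_const ε)
    rw [max_eq_left hm] at this
    refine this.congr fun x => ?_
    simp only [Pi.sup_apply]
    rw [max_add]
    congr 1; ring

lemma C_isCall {μ : ℕ → Measure ℝ} {m ε : ℝ} (hε : 0 < ε) (hμ : ∀ n, MemM (μ n))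
    (hm : ∀ n, meanM (μ n) - ε ≤ m) (n : ℕ) : IsCall (C μ m ε n) m := by
  induction n with
  | zero => exact isCall_sup hε (isCall_base m) (hμ 0) (hm 0)
  | succ n ih => exact isCall_sup hε ih (hμ _) (hm _)

lemma C_mono (μ : ℕ → Measure ℝ) (m ε : ℝ) : Monotone (C μ m ε) :=
  monotone_nat_of_le_succ fun _ => le_sup_left

lemma C_ge (μ : ℕ → Measure ℝ) (m ε : ℝ) (n : ℕ) (x : ℝ) :
    callFn (μ n) x - ε ≤ C μ m ε n x := by
  cases n with
  | zero => exact le_max_right _ _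
  | succ n => exact le_max_right _ _

lemma C_le {μ : ℕ → Measure ℝ} {m ε : ℝ} (h : ∀ k n : ℕ, k ≤ n → ∀ x : ℝ,
          max (max (m - x) 0) (callFn (μ k) x - ε) ≤ callFn (μ n) x + ε) (l n : ℕ) (hl : n ≤ l)
    (x : ℝ) : C μ m ε n x ≤ callFn (μ l) x + ε := by
  induction n with
  | zero => exact h 0 l hl x
  | succ n ih =>
    exact max_le (ih (by omega)) ((le_max_right _ _).trans (h (n + 1) l hl x))

lemma dSL_le_iff {μ ν : Measure ℝ} {ε : ℝ} (hε : 0 < ε) :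
    dSL μ ν ≤ ENNReal.ofReal ε ↔ ∀ x, |callFn μ x - callFn ν x| ≤ ε := by
  unfold dSL
  rw [iSup_le_iff]
  exact forall_congr' fun x => ENNReal.ofReal_le_ofReal_iff hε.le

lemma backward {ε : ℝ} (hε : 0 < ε) {μ : ℕ → Measure ℝ} (hμ : ∀ n, MemM (μ n)) (m : ℝ)
    (hm : m ∈ ⋂ n : ℕ, Set.Icc (meanM (μ n) - ε) (meanM (μ n) + ε))
    (h : ∀ k n : ℕ, k ≤ n → ∀ x : ℝ,
          max (max (m - x) 0) (callFn (μ k) x - ε) ≤ callFn (μ n) x + ε) :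
    ∃ ν : ℕ → Measure ℝ, (∀ n, MemM (ν n)) ∧
        (∀ j k : ℕ, j ≤ k → ConvexOrder (ν j) (ν k)) ∧
        (∀ n, dSL (μ n) (ν n) ≤ ENNReal.ofReal ε) ∧ meanM (ν 0) = m := by
  rw [mem_iInter] at hm
  choose ν h1 h2 h3 using fun n => exists_measure (C_isCall hε hμ (fun n => (hm n).1) n)
  refine ⟨ν, h1, fun j k hjk => ?_, fun n => ?_, h3 0⟩
  · refine convexOrder_of_call (h1 j) (h1 k) (by rw [h3, h3]) fun x => ?_
    rw [h2, h2]
    exact C_mono μ m ε hjk x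
  · rw [dSL_le_iff hε]
    intro x
    rw [h2, abs_le]
    constructor
    · linarith [C_le h n n le_rfl x]
    · linarith [C_ge μ m ε n x]

lemma forward {ε : ℝ} (hε : 0 < ε) {μ : ℕ → Measure ℝ} (hμ : ∀ n, MemM (μ n))
    {ν : ℕ → Measure ℝ} (h1 : ∀ n, MemM (ν n))
    (h2 : ∀ j k : ℕ, j ≤ k → ConvexOrder (ν j) (ν k))
    (h3 : ∀ n, dSL (μ n) (ν n) ≤ ENNReal.ofReal ε) :
    ∃ m ∈ ⋂ n : ℕ, Set.Icc (meanM (μ n) - ε) (meanM (μ n) + ε),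
        ∀ k n : ℕ, k ≤ n → ∀ x : ℝ,
          max (max (m - x) 0) (callFn (μ k) x - ε) ≤ callFn (μ n) x + ε := by
  have hd : ∀ n x, |callFn (μ n) x - callFn (ν n) x| ≤ ε := fun n => (dSL_le_iff hε).1 (h3 n)
  have hmean : ∀ n, meanM (ν n) = meanM (ν 0) := by
    intro n
    have a := h2 0 n (Nat.zero_le n) (fun y => y) (convexOn_id convex_univ) (h1 0).2 (h1 n).2
    have b := h2 0 n (Nat.zero_le n) (fun y => -y) (concaveOn_id convex_univ).neg
      (h1 0).2.neg (h1 n).2.neg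
    rw [integral_neg, integral_neg] at b
    unfold meanM
    linarith
  have hcall : ∀ k n, k ≤ n → ∀ x, callFn (ν k) x ≤ callFn (ν n) x := by
    intro k n hkn x
    refine h2 k n hkn _ ?_ (int_call (h1 k) x) (int_call (h1 n) x)
    refine ConvexOn.sup (f := fun y => y - x) (g := fun _ => 0) ?_ (convexOn_const 0 convex_univ)
    exact (convexOn_id convex_univ).add (convexOn_const (-x) convex_univ)
  refine ⟨meanM (ν 0), ?_, ?_⟩
  · rw [mem_iInter]
    intro n
    have t := ((call_atBot (hμ n)).sub (call_atBot (h1 n))).abs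
    have := le_of_tendsto' t (fun x => by
      have := hd n x
      rwa [add_sub_add_right_eq_sub])
    rw [hmean, abs_le] at this
    constructor <;> linarith
  · intro k n hkn x
    have hn := (abs_le.1 (hd n x)).1
    refine max_le ?_ ?_
    · have := call_ge (h1 n) x
      rw [hmean] at this
      linarith
    · have := (abs_le.1 (hd k x)).2
      linarith [hcall k n hkn x]

end SL

/-- existence of a peacock within stop-loss distance `ε` iff there is
`m ∈ I` with `max{(m−x)⁺, R_k(x) − ε} ≤ R_n(x) + ε` for all `k ≤ n`, `x ∈ ℝ`;
the peacock can then be chosen with first mean `m`. -/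
theorem strassen_stoploss (ε : ℝ) (hε : 0 < ε) (μ : ℕ → Measure ℝ)
    (hμ : ∀ n, MemM (μ n))
    (hI : (⋂ n : ℕ, Set.Icc (meanM (μ n) - ε) (meanM (μ n) + ε)).Nonempty) :
    ((∃ ν : ℕ → Measure ℝ, (∀ n, MemM (ν n)) ∧
        (∀ j k : ℕ, j ≤ k → ConvexOrder (ν j) (ν k)) ∧
        (∀ n, dSL (μ n) (ν n) ≤ ENNReal.ofReal ε)) ↔
      (∃ m ∈ ⋂ n : ℕ, Set.Icc (meanM (μ n) - ε) (meanM (μ n) + ε),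
        ∀ k n : ℕ, k ≤ n → ∀ x : ℝ,
          max (max (m - x) 0) (callFn (μ k) x - ε) ≤ callFn (μ n) x + ε)) ∧
    (∀ m ∈ ⋂ n : ℕ, Set.Icc (meanM (μ n) - ε) (meanM (μ n) + ε),
      (∀ k n : ℕ, k ≤ n → ∀ x : ℝ,
          max (max (m - x) 0) (callFn (μ k) x - ε) ≤ callFn (μ n) x + ε) →
      ∃ ν : ℕ → Measure ℝ, (∀ n, MemM (ν n)) ∧
        (∀ j k : ℕ, j ≤ k → ConvexOrder (ν j) (ν k)) ∧
        (∀ n, dSL (μ n) (ν n) ≤ ENNReal.ofReal ε) ∧ meanM (ν 0) = m) := by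
  refine ⟨⟨?_, ?_⟩, fun m hm h => SL.backward hε hμ m hm h⟩
  · rintro ⟨ν, h1, h2, h3⟩
    exact SL.forward hε hμ h1 h2 h3
  · rintro ⟨m, hm, h⟩
    obtain ⟨ν, h1, h2, h3, _⟩ := SL.backward hε hμ m hm h
    exact ⟨ν, h1, h2, h3⟩
end
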